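/- arXiv:1712.01052 — 3 statements merged into one kernel-verified Lean document; each statement's English description precedes it below -/
import Mathlib

section
/- A finite group is Sol-approximated if and only if it is solvable. -/
/-- A bi-invariant metric on a group `G`. -/
def IsBiInvMetric {G : Type*} [Group G] (d : G → G → ℝ) : Prop :=
  (∀ g h, d g h = 0 ↔ g = h) ∧
  (∀ g h, d g h = d h g) ∧
  (∀ g h k, d g k ≤ d g h + d h k) ∧
  (∀ g h k, d (g * h) (g * k) = d h k) ∧
  (∀ g h k, d (h * g) (k * g) = d h k)

/-- `Γ` is approximated by the class of finite solvable groups equipped with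
bi-invariant metrics. -/
def IsSolApproximated (Γ : Type*) [Group Γ] : Prop :=
  ∃ δ : Γ → ℝ, (∀ g : Γ, 0 ≤ δ g) ∧ (∀ g : Γ, g ≠ 1 → 0 < δ g) ∧
    ∀ (S : Finset Γ) (ε : ℝ), 0 < ε →
      ∃ (G : Type) (_ : Group G) (_ : Finite G) (_ : IsSolvable G)
        (d : G → G → ℝ) (φ : Γ → G),
        IsBiInvMetric d ∧
        (∀ g h : Γ, g ∈ S → h ∈ S → g * h ∈ S → d (φ g * φ h) (φ (g * h)) < ε) ∧
        (∀ g ∈ S, δ g ≤ d 1 (φ g))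

open scoped commutatorElement

section CommutatorProducts

variable {G : Type*} [Group G] {k : ℕ}

/-- The ordered product of the commutators `⁅y j, t j⁆`. -/
def commProd (t y : Fin k → G) : G := (List.ofFn fun j => ⁅y j, t j⁆).prod

/-- The ordered product of the conjugates of `t j` by `y j`. -/
def conjProd (t y : Fin k → G) : G := (List.ofFn fun j => y j * t j * (y j)⁻¹).prod

lemma commProd_succ (t y : Fin (k + 1) → G) :
    commProd t y = ⁅y 0, t 0⁆ * commProd (fun i => t i.succ) (fun i => y i.succ) := by
  simp [commProd, List.ofFn_succ]

lemma conjProd_succ (t y : Fin (k + 1) → G) :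
    conjProd t y =
      y 0 * t 0 * (y 0)⁻¹ * conjProd (fun i => t i.succ) (fun i => y i.succ) := by
  simp [conjProd, List.ofFn_succ]

lemma map_conjProd {H : Type*} [Group H] (f : G →* H) (t y : Fin k → G) :
    f (conjProd t y) = conjProd (fun j => f (t j)) (fun j => f (y j)) := by
  simp [conjProd, map_list_prod, List.map_ofFn, Function.comp_def]

lemma map_commProd {H : Type*} [Group H] (f : G →* H) (t y : Fin k → G) :
    f (commProd t y) = (List.ofFn fun j => f ⁅y j, t j⁆).prod := by
  simp only [commProd, map_list_prod, List.map_ofFn, Function.comp_def]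

lemma conjProd_conj (s x y : Fin k → G) :
    conjProd (fun j => x j * s j * (x j)⁻¹) y = conjProd s (fun j => y j * x j) := by
  simp only [conjProd, mul_assoc, mul_inv_rev]

lemma mul_commutatorElement (a b t : G) : ⁅a * b, t⁆ = a * ⁅b, t⁆ * a⁻¹ * ⁅a, t⁆ := by
  simp only [commutatorElement_def]; group

/-- A product of conjugates is a product of commutators times the product of the elements. -/
lemma exists_conjProd_eq (t : Fin k → G) :
    ∃ u : Fin k → G,
      Subgroup.closure (Set.range t) ≤
        Subgroup.closure (Set.range fun j => u j * t j * (u j)⁻¹) ∧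
      ∀ y, conjProd t y =
        commProd (fun j => u j * t j * (u j)⁻¹) (fun j => u j * y j * (u j)⁻¹) *
          conjProd t 1 := by
  induction k with
  | zero => exact ⟨1, by simp, by simp [conjProd, commProd]⟩
  | succ k ih =>
    obtain ⟨u, hu, h⟩ := ih fun i => t i.succ
    refine ⟨Fin.cons 1 fun i => t 0 * u i, ?_, fun y => ?_⟩
    · set K := Subgroup.closure (Set.range fun j =>
        (Fin.cons 1 (fun i => t 0 * u i) : Fin (k + 1) → G) j * t j *
          ((Fin.cons 1 (fun i => t 0 * u i) : Fin (k + 1) → G) j)⁻¹) with hK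
      have h0 : t 0 ∈ K := Subgroup.subset_closure ⟨0, by simp⟩
      have h1 : Subgroup.closure (Set.range fun j => u j * t j.succ * (u j)⁻¹) ≤ K := by
        rw [Subgroup.closure_le]
        rintro _ ⟨j, rfl⟩
        have : t 0 * (u j * t j.succ * (u j)⁻¹) * (t 0)⁻¹ ∈ K :=
          Subgroup.subset_closure ⟨j.succ, by simp [mul_assoc]⟩
        have := K.mul_mem (K.mul_mem (K.inv_mem h0) this) h0
        simpa [mul_assoc] using this
      rw [Subgroup.closure_le]
      rintro _ ⟨j, rfl⟩
      refine Fin.cases h0 (fun i => ?_) j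
      exact h1 (hu (Subgroup.subset_closure ⟨i, rfl⟩))
    · have key : ∀ (n : ℕ) (a : G) (s z v : Fin n → G),
          commProd (fun j => a * v j * s j * (a * v j)⁻¹) (fun j => a * v j * z j * (a * v j)⁻¹)
            = a * commProd (fun j => v j * s j * (v j)⁻¹) (fun j => v j * z j * (v j)⁻¹)
              * a⁻¹ := by
        intro n a s z v
        have := map_commProd (MulAut.conj a).toMonoidHom
          (fun j => v j * s j * (v j)⁻¹) (fun j => v j * z j * (v j)⁻¹)
        simp only [MulEquiv.coe_toMonoidHom, MulAut.conj_apply] at this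
        rw [this, commProd]
        congr 2
        funext j
        simp only [commutatorElement_def]; group
      rw [conjProd_succ, commProd_succ, conjProd_succ, h]
      simp only [Fin.cons_zero, Fin.cons_succ]
      rw [key]
      simp only [commutatorElement_def, Pi.one_apply]
      have e : (fun i : Fin k => (1 : Fin (k+1) → G) i.succ) = 1 := rfl
      simp only [Pi.one_def]
      group

lemma List.prod_ofFn_mul_of_commute {H : Type*} [Monoid H] (f g : Fin k → H)
    (h : ∀ i j, Commute (f i) (g j)) :
    (List.ofFn fun j => f j * g j).prod = (List.ofFn f).prod * (List.ofFn g).prod := by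
  induction k with
  | zero => simp
  | succ k ih =>
    simp only [List.ofFn_succ, List.prod_cons]
    rw [ih _ _ fun i j => h i.succ j.succ]
    have : Commute (g 0) (List.ofFn fun i => f i.succ).prod := by
      refine Commute.list_prod_right _ _ ?_
      intro x hx
      obtain ⟨i, rfl⟩ := (List.mem_ofFn' _ _).1 hx
      exact (h i.succ 0).symm
    simp only [mul_assoc]
    rw [← mul_assoc (g 0), this.eq, mul_assoc]

lemma conj_eq_of_mem_center {z : G} (hz : z ∈ Subgroup.center G) (g : G) :
    g * z * g⁻¹ = z := by
  rw [Subgroup.mem_center_iff.1 hz g, mul_inv_cancel_right]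

section CentralCommutators

variable {L : Subgroup G} (hL : ⁅L, L⁆ ≤ Subgroup.center G) {x y c d : G}
include hL

lemma commutatorElement_mul_left_of_central (hy : y ∈ L) (hc : c ∈ L) :
    ⁅x * y, c⁆ = ⁅x, c⁆ * ⁅y, c⁆ := by
  have h := hL (Subgroup.commutator_mem_commutator hy hc)
  rw [mul_commutatorElement, conj_eq_of_mem_center h]
  exact (Subgroup.mem_center_iff.1 h _).symm

lemma commutatorElement_mul_right_of_central (hx : x ∈ L) (hd : d ∈ L) :
    ⁅x, c * d⁆ = ⁅x, c⁆ * ⁅x, d⁆ := by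
  have h := hL (Subgroup.commutator_mem_commutator hx hd)
  rw [show ⁅x, c * d⁆ = ⁅x, c⁆ * (c * ⁅x, d⁆ * c⁻¹) by
    simp only [commutatorElement_def]; group, conj_eq_of_mem_center h]

/-- The map `(x, c) ↦ ⁅x, c⁆` is invariant under conjugation, in the form of an adjunction. -/
lemma commutatorElement_commutator_adjoint [L.Normal] (hx : x ∈ L) (hd : d ∈ L) (s : G) :
    ⁅⁅x, s⁆, d⁆ = ⁅x, ⁅d, s⁻¹⁆⁆ := by
  have hn : ∀ l ∈ L, ∀ g : G, g * l * g⁻¹ ∈ L := (inferInstance : L.Normal).conj_mem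
  have h1 : s * x⁻¹ * s⁻¹ ∈ L := hn _ (L.inv_mem hx) s
  have h2 : s⁻¹ * d⁻¹ * s ∈ L := by simpa only [inv_inv] using hn _ (L.inv_mem hd) s⁻¹
  have e1 : ⁅⁅x, s⁆, d⁆ = ⁅x, d⁆ * ⁅s * x⁻¹ * s⁻¹, d⁆ := by
    rw [← commutatorElement_mul_left_of_central hL h1 hd]
    congr 1
    simp only [commutatorElement_def]; group
  have e2 : ⁅x, ⁅d, s⁻¹⁆⁆ = ⁅x, d⁆ * ⁅x, s⁻¹ * d⁻¹ * s⁆ := by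
    rw [← commutatorElement_mul_right_of_central hL hx h2]
    congr 1
    simp only [commutatorElement_def]; group
  rw [e1, e2, ← conj_eq_of_mem_center (hL (Subgroup.commutator_mem_commutator h1 hd))
    (s⁻¹ * d⁻¹ * s * x * s⁻¹)]
  simp only [commutatorElement_def]; group

end CentralCommutators

variable {L B : Subgroup G} [L.Normal] [B.Normal]

lemma commute_mk_of_commutator_mem {x y : G} (h : ⁅x, y⁆ ∈ B) :
    Commute (x : G ⧸ B) (y : G ⧸ B) := by
  rw [← commutatorElement_eq_one_iff_commute]
  exact (QuotientGroup.eq_one_iff ⁅x, y⁆).2 h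

/-- Modulo a subgroup containing `⁅L, ⁅L, G⁆⁆`, the map `y ↦ ∏ ⁅y j, t j⁆` is a homomorphism. -/
def commProdHom (hB : ⁅L, ⁅L, (⊤ : Subgroup G)⁆⁆ ≤ B) (t : Fin k → G) :
    (Fin k → L) →* G ⧸ B :=
  MonoidHom.mk' (fun y => ((commProd t fun j => (y j : G) : G) : G ⧸ B)) <| by
    intro a b
    have hL : ∀ (y : L) (g : G), ⁅(y : G), g⁆ ∈ ⁅L, (⊤ : Subgroup G)⁆ := fun y g =>
      Subgroup.commutator_mem_commutator y.2 (Subgroup.mem_top g)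
    have hle : ⁅L, (⊤ : Subgroup G)⁆ ≤ L := Subgroup.commutator_le_left _ _
    have hc : ∀ (x : G) (y : L) (g : G), x ∈ L →
        Commute (x : G ⧸ B) ((⁅(y : G), g⁆ : G) : G ⧸ B) := fun x y g hx =>
      commute_mk_of_commutator_mem (hB (Subgroup.commutator_mem_commutator hx (hL y g)))
    have hm : ∀ y : Fin k → L, ((commProd t fun j => (y j : G) : G) : G ⧸ B) =
        (List.ofFn fun j => ((⁅(y j : G), t j⁆ : G) : G ⧸ B)).prod := fun y =>
      map_commProd (QuotientGroup.mk' B) t _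
    rw [hm, hm, hm, ← List.prod_ofFn_mul_of_commute]
    · congr 2
      funext j
      have h1 := hc (a j) (b j) (t j) (a j).2
      have h2 := hc ⁅(a j : G), t j⁆ (b j) (t j) (hle (hL _ _))
      simp only [Pi.mul_apply, Subgroup.coe_mul]
      rw [mul_commutatorElement, QuotientGroup.mk_mul, QuotientGroup.mk_mul,
        QuotientGroup.mk_mul, h1.eq, QuotientGroup.mk_inv, mul_inv_cancel_right, h2.eq]
    · exact fun i j => hc _ _ _ (hle (hL _ _))

@[simp] lemma commProdHom_apply (hB : ⁅L, ⁅L, (⊤ : Subgroup G)⁆⁆ ≤ B) (t : Fin k → G)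
    (y : Fin k → L) :
    commProdHom hB t y = ((commProd t fun j => (y j : G) : G) : G ⧸ B) := rfl

omit [L.Normal] in
lemma commProd_mem (t : Fin k → G) (y : Fin k → L) :
    commProd t (fun j => (y j : G)) ∈ ⁅L, (⊤ : Subgroup G)⁆ := by
  refine Subgroup.list_prod_mem _ ?_
  intro x hx
  obtain ⟨i, rfl⟩ := (List.mem_ofFn' _ _).1 hx
  exact Subgroup.commutator_mem_commutator (y i).2 (Subgroup.mem_top _)

lemma commProd_mulSingle (t : Fin k → G) (i : Fin k) (l : G) :
    commProd t (Pi.mulSingle i l) = ⁅l, t i⁆ := by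
  induction k with
  | zero => exact i.elim0
  | succ k ih =>
    rw [commProd_succ]
    refine Fin.cases ?_ (fun i => ?_) i
    · simp [commProd]
    · have h0 : (Pi.mulSingle i.succ l : Fin (k + 1) → G) 0 = 1 :=
        Pi.mulSingle_eq_of_ne (Fin.succ_ne_zero i).symm _
      have : (fun j : Fin k => (Pi.mulSingle i.succ l : Fin (k + 1) → G) j.succ)
          = Pi.mulSingle i l := by
        funext j
        by_cases h : j = i
        · subst h; simp
        · rw [Pi.mulSingle_eq_of_ne h, Pi.mulSingle_eq_of_ne (by simpa using h)]
      rw [h0, this, ih]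
      simp

lemma commProdHom_range (hB : ⁅L, ⁅L, (⊤ : Subgroup G)⁆⁆ ≤ B) (t : Fin k → G)
    (ht : Subgroup.closure (Set.range t) ⊔ ⁅L, (⊤ : Subgroup G)⁆ = ⊤) :
    (commProdHom hB t).range = ⁅L, (⊤ : Subgroup G)⁆.map (QuotientGroup.mk' B) := by
  set I := (commProdHom hB t).range with hI
  set N := ⁅L, (⊤ : Subgroup G)⁆ with hN
  have hNL : N ≤ L := Subgroup.commutator_le_left _ _
  refine le_antisymm ?_ ?_
  · rintro _ ⟨y, rfl⟩
    exact ⟨_, commProd_mem t y, rfl⟩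
  rw [Subgroup.map_le_iff_le_comap, hN, Subgroup.commutator_le]
  suffices h : ∀ g ∈ Subgroup.closure (Set.range t ∪ (N : Set G)), ∀ l ∈ L,
      ((⁅l, g⁆ : G) : G ⧸ B) ∈ I by
    intro l hl g _
    refine h g ?_ l hl
    rw [Subgroup.closure_union, Subgroup.closure_eq, ht]
    trivial
  intro g hg
  induction hg using Subgroup.closure_induction with
  | mem g hg =>
    intro l hl
    rcases hg with ⟨j, rfl⟩ | hg
    · refine ⟨Pi.mulSingle j ⟨l, hl⟩, ?_⟩
      rw [commProdHom_apply, ← commProd_mulSingle t j l]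
      congr 2
      funext i
      by_cases h : i = j
      · subst h; simp
      · simp [Pi.mulSingle_eq_of_ne h]
    · have : ((⁅l, g⁆ : G) : G ⧸ B) = 1 :=
        (QuotientGroup.eq_one_iff _).2 (hB (Subgroup.commutator_mem_commutator hl hg))
      rw [this]
      exact I.one_mem
  | one => intro l _; simp
  | mul g h _ _ ihg ihh =>
    intro l hl
    have hx : ⁅l, h⁆ ∈ L := hNL (Subgroup.commutator_mem_commutator hl (Subgroup.mem_top _))
    have e : ⁅l, g * h⁆ = ⁅l, g⁆ * (⁅⁅l, h⁆, g⁆⁻¹ * ⁅l, h⁆) := by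
      simp only [commutatorElement_def]; group
    rw [e]
    exact I.mul_mem (ihg l hl) (I.mul_mem (I.inv_mem (ihg _ hx)) (ihh l hl))
  | inv g _ ih =>
    intro l hl
    have e : ⁅l, g⁻¹⁆ = ⁅g⁻¹ * l * g, g⁆⁻¹ := by
      simp only [commutatorElement_def]; group
    rw [e]
    refine I.inv_mem (ih _ ?_)
    simpa only [inv_inv] using Subgroup.Normal.conj_mem ‹_› l hl g⁻¹

/-- The deviation of `y ↦ ∏ ⁅y j, t j⁆` from being multiplicative on `L` when `⁅L, L⁆` is
central. -/
lemma exists_commProd_mul (hL : ⁅L, L⁆ ≤ Subgroup.center G) (t : Fin k → G) :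
    ∃ e : (Fin k → L) → Fin k → L,
      (∀ b b' i, (∀ j, i < j → b j = b' j) → e b i = e b' i) ∧
      ∀ a b : Fin k → L, commProd t (fun j => ((a * b) j : G)) =
        commProd t (fun j => (b j : G)) * commProd t (fun j => (a j : G)) *
          (List.ofFn fun j => ⁅(a j : G), ⁅(b j : G), t j⁆ * (e b j : G)⁆).prod := by
  have hNL : ⁅L, (⊤ : Subgroup G)⁆ ≤ L := Subgroup.commutator_le_left _ _
  have hcen : ∀ x ∈ L, ∀ y ∈ L, ⁅x, y⁆ ∈ Subgroup.center G := fun x hx y hy =>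
    hL (Subgroup.commutator_mem_commutator hx hy)
  have hmem : ∀ l ∈ L, ∀ g : G, ⁅l, g⁆ ∈ L := fun l hl g =>
    hNL (Subgroup.commutator_mem_commutator hl (Subgroup.mem_top g))
  induction k with
  | zero => exact ⟨fun _ => 1, fun _ _ i => i.elim0, fun a b => by simp [commProd]⟩
  | succ k ih =>
    obtain ⟨e, he, h⟩ := ih fun i => t i.succ
    refine ⟨fun b => Fin.cons
      ⟨⁅commProd (fun i => t i.succ) (fun i => (b i.succ : G)), (t 0)⁻¹⁆,
        hmem _ (hNL (commProd_mem _ fun i => b i.succ)) _⟩ (e fun i => b i.succ), ?_, ?_⟩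
    · intro b b' i
      refine Fin.cases (fun hb => ?_) (fun i hb => ?_) i
      · have : (fun i : Fin k => b i.succ) = fun i => b' i.succ :=
          funext fun i => hb _ (Fin.succ_pos i)
        simp only [Fin.cons_zero, Subtype.mk.injEq]
        simp only [funext_iff] at this
        simp only [this]
      · simp only [Fin.cons_succ]
        exact he _ _ _ fun j hj => hb _ (Fin.succ_lt_succ_iff.2 hj)
    · intro a b
      have h' := h (fun i => a i.succ) (fun i => b i.succ)
      rw [commProd_succ]
      simp only [Pi.mul_apply] at h' ⊢
      rw [h', commProd_succ t, commProd_succ t]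
      simp only [List.ofFn_succ, List.prod_cons, Fin.cons_zero, Fin.cons_succ]
      have hD : commProd (fun i => t i.succ) (fun i => (b i.succ : G)) ∈ L :=
        hNL (commProd_mem _ fun i => b i.succ)
      set D := commProd (fun i => t i.succ) (fun i => (b i.succ : G))
      set F := commProd (fun i => t i.succ) (fun i => (a i.succ : G))
      set R := (List.ofFn fun i : Fin k => ⁅(a i.succ : G), ⁅(b i.succ : G), t i.succ⁆ *
        (e (fun i => b i.succ) i : G)⁆).prod
      have hx : (a 0 : G) ∈ L := (a 0).2
      have hy : (b 0 : G) ∈ L := (b 0).2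
      simp only [Subgroup.coe_mul]
      generalize (a 0 : G) = x at *
      generalize (b 0 : G) = y at *
      generalize t 0 = s at *
      have key : ⁅x * y, s⁆ * D = ⁅x, ⁅y, s⁆ * ⁅D, s⁻¹⁆⁆ * (⁅y, s⁆ * D * ⁅x, s⁆) := by
        have ha := hmem x hx s
        rw [commutatorElement_mul_right_of_central hL hx (hmem D hD _),
          ← commutatorElement_commutator_adjoint hL hx hD s, mul_assoc ⁅x, ⁅y, s⁆⁆]
        have hz := Subgroup.mem_center_iff.1 (hcen _ ha _ hD) ⁅y, s⁆
        rw [show ⁅⁅x, s⁆, D⁆ * (⁅y, s⁆ * D * ⁅x, s⁆) = ⁅y, s⁆ * ⁅⁅x, s⁆, D⁆ * (D * ⁅x, s⁆) by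
          rw [hz]; simp only [mul_assoc]]
        simp only [commutatorElement_def]; group
      rw [← mul_assoc, ← mul_assoc, key]
      have hz := hcen x hx (⁅y, s⁆ * ⁅D, s⁻¹⁆) (L.mul_mem (hmem y hy s) (hmem D hD _))
      generalize ⁅x, ⁅y, s⁆ * ⁅D, s⁻¹⁆⁆ = z at *
      rw [Subgroup.mem_center_iff] at hz
      rw [← hz]
      have h3 := hz R
      have h4 := hz F
      simp only [mul_assoc]
      rw [← mul_assoc z F, ← h4, mul_assoc F z]

end CommutatorProducts

section Counting

open Classical in
lemma card_mul_prod_index_le {L : Type*} [Group L] [Finite L] {k : ℕ} (S : Set (Fin k → L))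
    (C : Fin k → Subgroup L)
    (h : ∀ b ∈ S, ∀ b' ∈ S, ∀ i, (∀ j, i < j → b j = b' j) → (b i)⁻¹ * b' i ∈ C i) :
    Nat.card S * ∏ i, (C i).index ≤ Nat.card L ^ k := by
  suffices hS : ∀ S : Finset (Fin k → L),
      (∀ b ∈ S, ∀ b' ∈ S, ∀ i, (∀ j, i < j → b j = b' j) → (b i)⁻¹ * b' i ∈ C i) →
        S.card ≤ ∏ i, Nat.card (C i) by
    have := Fintype.ofFinite L
    have h1 := hS S.toFinset (by simpa using h)
    rw [← Set.ncard_eq_toFinset_card'] at h1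
    calc Nat.card S * ∏ i, (C i).index ≤ (∏ i, Nat.card (C i)) * ∏ i, (C i).index :=
          Nat.mul_le_mul_right _ h1
      _ = Nat.card L ^ k := by
          rw [← Finset.prod_mul_distrib]
          simp only [Subgroup.card_mul_index, Finset.prod_const, Finset.card_univ, Fintype.card_fin]
  clear h S
  intro S h
  induction k with
  | zero => simpa using Finset.card_le_one_of_subsingleton S
  | succ k ih =>
    have hT := ih (fun i => C i.succ) (S.image fun b i => b i.succ) (by
      simp only [Finset.mem_image, forall_exists_index, and_imp, forall_apply_eq_imp_iff₂]
      intro b hb b' hb' i hi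
      refine h b hb b' hb' i.succ fun j => ?_
      refine Fin.cases (fun h0 => absurd h0 (Fin.not_lt_zero _)) (fun j hj => ?_) j
      exact hi j (Fin.succ_lt_succ_iff.1 hj))
    rw [Fin.prod_univ_succ, mul_comm]
    refine (Finset.card_le_mul_card_image (f := fun b i => b (Fin.succ i)) S (Nat.card (C 0))
      ?_).trans
      ((Nat.mul_le_mul_left _ hT).trans_eq (mul_comm _ _))
    intro c hc
    obtain ⟨b, hb, rfl⟩ := Finset.mem_image.1 hc
    have hmem : ∀ b' ∈ S.filter (fun a => (fun i => a (Fin.succ i)) = fun i => b (Fin.succ i)),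
        (b 0)⁻¹ * b' 0 ∈ C 0 := by
      intro b' hb'
      obtain ⟨h1, h2⟩ := Finset.mem_filter.1 hb'
      refine h b hb b' h1 0 fun j => ?_
      refine Fin.cases (fun h0 => absurd h0 (lt_irrefl _)) (fun j _ => ?_) j
      exact (congrFun h2 j).symm
    have := Fintype.ofFinite (C 0)
    rw [← Fintype.card_coe, Nat.card_eq_fintype_card]
    refine Fintype.card_le_of_injective (fun b' => ⟨_, hmem b'.1 b'.2⟩) ?_
    intro x y hxy
    have h0 : x.1 0 = y.1 0 := by simpa using hxy
    have hx := (Finset.mem_filter.1 x.2).2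
    have hy := (Finset.mem_filter.1 y.2).2
    refine Subtype.ext (funext fun j => ?_)
    refine Fin.cases h0 (fun j => ?_) j
    exact (congrFun hx j).trans (congrFun hy j).symm

lemma card_fiber_mul_card {X H : Type*} [Group X] [Finite X] [Group H] (f : X →* H) (x : X) :
    Nat.card {y // f y = f x} * Nat.card f.range = Nat.card X := by
  rw [← Subgroup.index_ker, ← Subgroup.card_mul_index f.ker]
  congr 1
  refine Nat.card_congr ⟨fun y => ⟨x⁻¹ * y.1, ?_⟩, fun z => ⟨x * z.1, ?_⟩, ?_, ?_⟩
  · rw [MonoidHom.mem_ker, map_mul, y.2, map_inv, inv_mul_cancel]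
  · rw [map_mul, z.2, mul_one]
  · intro y; simp
  · intro z; simp

lemma card_map_mk_mul_card {G : Type*} [Group G] {N A : Subgroup G} [A.Normal] (h : A ≤ N) :
    Nat.card (N.map (QuotientGroup.mk' A)) * Nat.card A = Nat.card N := by
  have h1 := Subgroup.card_mul_index ((QuotientGroup.mk' A).comp N.subtype).ker
  rw [Subgroup.index_ker, MonoidHom.range_comp, Subgroup.range_subtype] at h1
  rw [← h1, mul_comm]
  congr 1
  have h2 : ((QuotientGroup.mk' A).comp N.subtype).ker = A.subgroupOf N := by
    ext x
    simp [Subgroup.mem_subgroupOf, MonoidHom.mem_ker]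
  rw [h2]
  exact (Nat.card_congr (Subgroup.subgroupOfEquivOfLe h).toEquiv).symm

open Classical in
/-- Second moment bound for the fibres of a map `E : X → N` that is a homomorphism up to a
bimultiplicative error with values in a central subgroup `A`. -/
lemma sq_sub_card_fiber_le {X G : Type*} [Group X] [Finite X] [Group G] [Finite G]
    {N A : Subgroup G} [A.Normal] (hAN : A ≤ N) (hA : A ≤ Subgroup.center G)
    (E : X → G) (β : X → X → G) (hE : ∀ a b, E (a * b) = E b * E a * β a b)
    (hβA : ∀ a b, β a b ∈ A) (hβ : ∀ a a' b, β (a * a') b = β a b * β a' b)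
    (bad : Set X) (hbad : ∀ b ∉ bad, ∀ z ∈ A, ∃ a, β a b = z)
    (ψ : X →* G ⧸ A) (hψ : ∀ x, ψ x = (E x : G ⧸ A))
    (hrange : ψ.range = N.map (QuotientGroup.mk' A)) {r : G} (hr : r ∈ N) :
    ((Nat.card X : ℝ) / Nat.card N - Nat.card {x // E x = r}) ^ 2 ≤
      Nat.card bad * Nat.card X := by
  have := Fintype.ofFinite X
  have := Fintype.ofFinite G
  have hEN : ∀ x, E x ∈ N := by
    intro x
    have : ψ x ∈ N.map (QuotientGroup.mk' A) := hrange ▸ ⟨x, rfl⟩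
    obtain ⟨n, hn, h⟩ := this
    rw [hψ] at h
    have := QuotientGroup.eq.1 (h : (n : G ⧸ A) = E x)
    simpa using N.mul_mem hn (hAN this)
  let f : G → ℕ := fun r => (Finset.univ.filter fun x => E x = r).card
  let g : X → ℕ := fun b => (Finset.univ.filter fun x => E (x * b) = E x).card
  let M : Finset G := Finset.univ.filter (· ∈ N)
  have hf : Nat.card {x // E x = r} = f r := by
    rw [Nat.card_eq_fintype_card, Fintype.card_subtype]
  have hM : M.card = Nat.card N := by
    rw [Nat.card_eq_fintype_card, Fintype.card_subtype]
  have hmaps : ∀ x ∈ (Finset.univ : Finset X), E x ∈ M := fun x _ => by simp [M, hEN]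
  have hsum1 : ∑ r ∈ M, f r = Nat.card X := by
    rw [Nat.card_eq_fintype_card, ← Finset.card_univ]
    exact (Finset.card_eq_sum_card_fiberwise hmaps).symm
  have hsum2 : ∑ r ∈ M, f r ^ 2 = ∑ b, g b := by
    have h1 : ∑ r ∈ M, f r ^ 2 = ∑ x, f (E x) := by
      rw [← Finset.sum_fiberwise_of_maps_to hmaps]
      refine Finset.sum_congr rfl fun r _ => ?_
      rw [Finset.sum_congr rfl (g := fun _ => f r)
        (fun x hx => by rw [(Finset.mem_filter.1 hx).2])]
      simp [f, sq]
    rw [h1]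
    simp only [f, g, Finset.card_filter]
    rw [Finset.sum_comm (f := fun b x => if E (x * b) = E x then 1 else 0)]
    refine Finset.sum_congr rfl fun x _ => ?_
    exact (Equiv.sum_comp (Equiv.mulLeft x) fun y => if E y = E x then 1 else 0).symm
  have hApos : 0 < Nat.card A := Nat.card_pos
  have hg : ∀ b, g b * Nat.card A ≤
      (if b ∈ ψ.ker then Nat.card X else 0) + (if b ∈ bad then Nat.card X * Nat.card A else 0) := by
    intro b
    by_cases hb : b ∈ bad
    · have : g b ≤ Nat.card X := by
        rw [Nat.card_eq_fintype_card]; exact Finset.card_le_univ _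
      rw [if_pos hb]
      exact (Nat.mul_le_mul_right _ this).trans (Nat.le_add_left _ _)
    have hiff : ∀ x, E (x * b) = E x ↔ β x b = (E b)⁻¹ := by
      intro x
      have hc := Subgroup.mem_center_iff.1 (hA (hβA x b)) (E x)
      rw [hE, mul_assoc, hc, ← mul_assoc, mul_eq_right, mul_eq_one_iff_inv_eq]
      exact eq_comm
    by_cases hk : b ∈ ψ.ker
    · rw [if_pos hk, if_neg hb, add_zero]
      have hbA : E b ∈ A := by
        rw [MonoidHom.mem_ker, hψ] at hk
        exact (QuotientGroup.eq_one_iff _).1 hk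
      let F : X →* G := MonoidHom.mk' (fun a => β a b) fun a a' => hβ a a' b
      obtain ⟨a, ha⟩ := hbad b hb _ (A.inv_mem hbA)
      have hF : F.range = A := by
        refine le_antisymm ?_ fun z hz => hbad b hb z hz
        rintro _ ⟨a, rfl⟩
        exact hβA a b
      have h1 := card_fiber_mul_card F a
      rw [hF] at h1
      rw [← h1]
      refine Nat.mul_le_mul_right _ (le_of_eq ?_)
      rw [Nat.card_eq_fintype_card, Fintype.card_subtype]
      simp only [g, hiff, ← ha]
      rfl
    · have : g b = 0 := by
        refine Finset.card_eq_zero.2 (Finset.filter_eq_empty_iff.2 fun x _ hx => hk ?_)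
        rw [hiff] at hx
        rw [MonoidHom.mem_ker, hψ]
        refine (QuotientGroup.eq_one_iff _).2 ?_
        have := A.inv_mem (hβA x b)
        rwa [hx, inv_inv] at this
      simp [this]
  have hgsum : (∑ b, g b) * Nat.card A ≤
      Nat.card ψ.ker * Nat.card X + Nat.card bad * (Nat.card X * Nat.card A) := by
    rw [Finset.sum_mul]
    refine (Finset.sum_le_sum fun b _ => hg b).trans_eq ?_
    rw [Finset.sum_add_distrib, ← Finset.sum_filter, ← Finset.sum_filter, Finset.sum_const,
      Finset.sum_const, smul_eq_mul, smul_eq_mul, Nat.card_eq_fintype_card (α := ψ.ker),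
      Nat.card_eq_fintype_card (α := bad), Fintype.card_subtype, Fintype.card_subtype]
  have hker : Nat.card ψ.ker * Nat.card N = Nat.card X * Nat.card A := by
    rw [← card_map_mk_mul_card hAN, ← hrange, ← Subgroup.index_ker, ← mul_assoc,
      Subgroup.card_mul_index]
  have hNpos : 0 < Nat.card N := Nat.card_pos
  rw [hf]
  have hq : (∑ r ∈ M, (f r : ℝ) ^ 2) = ((∑ b, g b : ℕ) : ℝ) := by
    rw [← hsum2]; push_cast; rfl
  have hs : (∑ r ∈ M, (f r : ℝ)) = Nat.card X := by
    rw [← hsum1]; push_cast; rfl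
  have hA' : (0 : ℝ) < Nat.card A := by exact_mod_cast hApos
  have hN' : (0 : ℝ) < Nat.card N := by exact_mod_cast hNpos
  have hgsum' : ((∑ b, g b : ℕ) : ℝ) * Nat.card A ≤
      Nat.card ψ.ker * Nat.card X + Nat.card bad * (Nat.card X * Nat.card A) := by
    exact_mod_cast hgsum
  have hker' : (Nat.card ψ.ker : ℝ) = Nat.card X * Nat.card A / Nat.card N := by
    rw [eq_div_iff hN'.ne']; exact_mod_cast hker
  have hG : ((∑ b, g b : ℕ) : ℝ) ≤
      (Nat.card X : ℝ) ^ 2 / Nat.card N + Nat.card bad * Nat.card X := by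
    rw [hker'] at hgsum'
    refine le_of_mul_le_mul_right (hgsum'.trans_eq ?_) hA'
    field_simp
  calc ((Nat.card X : ℝ) / Nat.card N - f r) ^ 2
      ≤ ∑ r ∈ M, ((Nat.card X : ℝ) / Nat.card N - f r) ^ 2 :=
        Finset.single_le_sum (f := fun r => ((Nat.card X : ℝ) / Nat.card N - f r) ^ 2)
          (fun _ _ => sq_nonneg _) (by simp [M, hr])
    _ = ((∑ b, g b : ℕ) : ℝ) - (Nat.card X : ℝ) ^ 2 / Nat.card N := by
        simp only [sub_sq, Finset.sum_add_distrib, Finset.sum_sub_distrib, Finset.sum_const,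
          ← Finset.mul_sum, hq, hs, nsmul_eq_mul, hM]
        field_simp
        ring
    _ ≤ _ := by linarith

end Counting

section Relators

variable {P G : Type*} [Group P] [Group G]

/-- The defect of multiplicativity of `φ` at `(g, h)`. -/
def relator (φ : P → G) (q : P × P) : G := (φ (q.1 * q.2))⁻¹ * (φ q.1 * φ q.2)

lemma map_relator {H : Type*} [Group H] (f : G →* H) (φ : P → G) (q : P × P) :
    f (relator φ q) = relator (f ∘ φ) q := by
  simp [relator]

lemma eq_one_of_commutator_eq_top (hP : commutator P = ⊤) [Group.IsSolvable G] (f : P →* G)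
    (p : P) :
    f p = 1 := by
  obtain ⟨n, hn⟩ := ‹Group.IsSolvable G›.solvable
  have htop : ∀ n, derivedSeries P n = ⊤ := by
    intro n
    induction n with
    | zero => rfl
    | succ n ih => rw [derivedSeries_succ, ih]; exact hP
  have h := map_derivedSeries_le_derivedSeries f n
  rw [htop, hn] at h
  exact (Subgroup.mem_bot).1 (h ⟨p, trivial, rfl⟩)

/-- If the relators of a map from a perfect group with solvable hull have a common nontrivial
centralizing element in a minimal normal subgroup, then that subgroup is central. -/
lemma le_center_of_commute_relator (hP : commutator P = ⊤) [Group.IsSolvable G] {φ : P → G}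
    (hφ : Subgroup.closure (Set.range φ) = ⊤) {L : Subgroup G} [L.Normal]
    (hmin : ∀ M : Subgroup G, M.Normal → M ≤ L → M = ⊥ ∨ M = L) {v : G} (hvL : v ∈ L)
    (hv : v ≠ 1) (hrel : ∀ q, Commute (relator φ q) v) : L ≤ Subgroup.center G := by
  have hact : ∀ k l, φ k * φ l * v * (φ k * φ l)⁻¹ = φ (k * l) * v * (φ (k * l))⁻¹ := by
    intro k l
    have h := (hrel (k, l)).eq
    have e : φ k * φ l = φ (k * l) * relator φ (k, l) := by simp [relator]
    rw [e, mul_inv_rev]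
    simp only [mul_assoc]
    rw [← mul_assoc (relator φ (k, l)) v, h]
    simp [mul_assoc]
  set T : Set G := Set.range fun g => φ g * v * (φ g)⁻¹ with hT
  set U := Subgroup.closure T with hU
  have hstep : ∀ k g, φ k * (φ g * v * (φ g)⁻¹) * (φ k)⁻¹ = φ (k * g) * v * (φ (k * g))⁻¹ := by
    intro k g
    rw [← hact]; group
  have hconj : ∀ k, ∀ x ∈ U, φ k * x * (φ k)⁻¹ ∈ U := by
    intro k
    change U ≤ U.comap (MulAut.conj (φ k)).toMonoidHom
    rw [hU, Subgroup.closure_le]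
    rintro _ ⟨g, rfl⟩
    exact Subgroup.subset_closure ⟨k * g, (hstep k g).symm⟩
  have hconj' : ∀ k, ∀ x ∈ U, (φ k)⁻¹ * x * φ k ∈ U := by
    intro k
    suffices h : U ≤ U.comap (MulAut.conj (φ k)⁻¹).toMonoidHom by
      intro x hx
      simpa using h hx
    rw [hU, Subgroup.closure_le]
    rintro _ ⟨g, rfl⟩
    refine Subgroup.subset_closure ⟨k⁻¹ * g, ?_⟩
    have := hstep k (k⁻¹ * g)
    rw [mul_inv_cancel_left] at this
    simp only [MulEquiv.coe_toMonoidHom, MulAut.conj_apply, ← this]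
    group
  have hUn : U.Normal := by
    rw [← Subgroup.normalizer_eq_top_iff, eq_top_iff, ← hφ, Subgroup.closure_le]
    rintro _ ⟨k, rfl⟩
    rw [SetLike.mem_coe, Subgroup.mem_normalizer_iff]
    refine fun x => ⟨hconj k x, fun hx => ?_⟩
    have := hconj' k _ hx
    simpa [mul_assoc] using this
  have hUL : U ≤ L := by
    rw [hU, Subgroup.closure_le]
    rintro _ ⟨g, rfl⟩
    exact Subgroup.Normal.conj_mem ‹_› v hvL _
  have hUeq : U = L := by
    refine (hmin U hUn hUL).resolve_left fun h => hv ?_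
    have : φ 1 * v * (φ 1)⁻¹ ∈ U := Subgroup.subset_closure ⟨1, rfl⟩
    rw [h, Subgroup.mem_bot] at this
    simpa using this
  have hcent : ∀ q, ∀ x ∈ L, Commute (relator φ q) x := by
    rintro ⟨k, l⟩
    rw [← hUeq]
    suffices U ≤ Subgroup.centralizer {relator φ (k, l)} by
      intro x hx
      exact (Subgroup.mem_centralizer_singleton_iff.1 (this hx)).symm
    rw [hU, Subgroup.closure_le]
    rintro _ ⟨g, rfl⟩
    rw [SetLike.mem_coe, Subgroup.mem_centralizer_singleton_iff]
    have h1 : φ k * (φ l * (φ g * v * (φ g)⁻¹) * (φ l)⁻¹) * (φ k)⁻¹ =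
        φ (k * l) * (φ g * v * (φ g)⁻¹) * (φ (k * l))⁻¹ := by
      rw [hstep, hstep, hstep, ← mul_assoc k l g]
    have e : φ k * φ l = φ (k * l) * relator φ (k, l) := by simp [relator]
    change φ g * v * (φ g)⁻¹ * _ = _ * (φ g * v * (φ g)⁻¹)
    generalize φ g * v * (φ g)⁻¹ = w at h1 ⊢
    have h2 : φ (k * l) * (relator φ (k, l) * w * (relator φ (k, l))⁻¹) * (φ (k * l))⁻¹ =
        φ (k * l) * w * (φ (k * l))⁻¹ := by
      rw [← h1]
      have : φ k * (φ l * w * (φ l)⁻¹) * (φ k)⁻¹ = (φ k * φ l) * w * (φ k * φ l)⁻¹ := by group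
      rw [this, e]; group
    rw [mul_left_inj, mul_right_inj, mul_inv_eq_iff_eq_mul] at h2
    exact h2.symm
  let ρ : G →* MulAut L := MulAut.conjNormal
  have hρrel : ∀ q, ρ (relator φ q) = 1 := by
    intro q
    ext x
    simp only [ρ, MulAut.conjNormal_apply, MulAut.one_apply]
    rw [(hcent q x x.2).eq, mul_inv_cancel_right]
  let f : P →* ρ.range := MonoidHom.mk' (fun g => ⟨ρ (φ g), φ g, rfl⟩) <| by
    intro k l
    have := hρrel (k, l)
    rw [relator, map_mul, map_inv, inv_mul_eq_one, map_mul] at this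
    exact Subtype.ext this
  have : Group.IsSolvable ρ.range := Group.isSolvable_of_surjective ρ.rangeRestrict_surjective
  have hker : ρ.ker = ⊤ := by
    rw [eq_top_iff, ← hφ, Subgroup.closure_le]
    rintro _ ⟨g, rfl⟩
    exact congrArg Subtype.val (eq_one_of_commutator_eq_top hP f g)
  intro x hx
  rw [Subgroup.mem_center_iff]
  intro g
  have hg : ρ g = 1 := MonoidHom.mem_ker.1 (hker ▸ Subgroup.mem_top g)
  have := congrArg (fun m : MulAut L => ((m ⟨x, hx⟩ : L) : G)) hg
  simp only [ρ, MulAut.conjNormal_apply, MulAut.one_apply] at this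
  exact mul_inv_eq_iff_eq_mul.1 this

end Relators

section Generation

variable {G : Type*} [Group G]

lemma commutator_le_of_sup_central {H Z : Subgroup G} (hZ : Z ≤ Subgroup.center G)
    (h : H ⊔ Z = ⊤) : commutator G ≤ H := by
  have hZn : Z.Normal := ⟨fun z hz g => by
    rw [conj_eq_of_mem_center (hZ hz)]; exact hz⟩
  rw [commutator_def, Subgroup.commutator_le]
  have key : ∀ g : G, ∃ x ∈ H, ∃ z ∈ Z, x * z = g := fun g =>
    Subgroup.mem_sup_of_normal_right.1 (h ▸ Subgroup.mem_top g)
  intro g _ g' _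
  obtain ⟨x, hx, z, hz, rfl⟩ := key g
  obtain ⟨x', hx', z', hz', rfl⟩ := key g'
  have e : ⁅x * z, x' * z'⁆ = ⁅x, x'⁆ := by
    have h1 : ∀ w, w * z = z * w := fun w => Subgroup.mem_center_iff.1 (hZ hz) w
    have h2 : ∀ w, w * z' = z' * w := fun w => Subgroup.mem_center_iff.1 (hZ hz') w
    simp only [commutatorElement_def, mul_inv_rev]
    calc x * z * (x' * z') * (z⁻¹ * x⁻¹) * (z'⁻¹ * x'⁻¹)
        = x * (z * (x' * z')) * z⁻¹ * x⁻¹ * z'⁻¹ * x'⁻¹ := by group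
      _ = x * (x' * z') * x⁻¹ * z'⁻¹ * x'⁻¹ := by rw [← h1]; group
      _ = x * x' * (z' * x⁻¹) * z'⁻¹ * x'⁻¹ := by group
      _ = _ := by rw [← h2]; group
  rw [e]
  exact H.mul_mem (H.mul_mem (H.mul_mem hx hx') (H.inv_mem hx)) (H.inv_mem hx')

variable {k : ℕ} {L : Subgroup G}

lemma closure_le_closure_conj_sup (t : Fin k → G) (y : Fin k → L) :
    Subgroup.closure (Set.range t) ≤
      Subgroup.closure (Set.range fun j => (y j : G) * t j * (y j : G)⁻¹) ⊔
        ⁅L, (⊤ : Subgroup G)⁆ := by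
  rw [Subgroup.closure_le]
  rintro _ ⟨j, rfl⟩
  have h1 : ⁅(y j : G), t j⁆ ∈ ⁅L, (⊤ : Subgroup G)⁆ :=
    Subgroup.commutator_mem_commutator (y j).2 (Subgroup.mem_top _)
  have h2 : (y j : G) * t j * (y j : G)⁻¹ ∈
      Subgroup.closure (Set.range fun j => (y j : G) * t j * (y j : G)⁻¹) :=
    Subgroup.subset_closure ⟨j, rfl⟩
  have e : t j = ⁅(y j : G), t j⁆⁻¹ * ((y j : G) * t j * (y j : G)⁻¹) := by
    simp only [commutatorElement_def]; group
  rw [SetLike.mem_coe, e]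
  exact Subgroup.mul_mem _ (Subgroup.mem_sup_right (Subgroup.inv_mem _ h1))
    (Subgroup.mem_sup_left h2)

lemma closure_conj_eq_top_of_central (hL : ⁅L, (⊤ : Subgroup G)⁆ ≤ Subgroup.center G)
    {t : Fin k → G} (ht : Subgroup.closure (Set.range t) ⊔ ⁅L, (⊤ : Subgroup G)⁆ = ⊤)
    (y : Fin k → L) :
    Subgroup.closure (Set.range fun j => (y j : G) * t j * (y j : G)⁻¹) = ⊤ := by
  have h1 : Subgroup.closure (Set.range fun j => (y j : G) * t j * (y j : G)⁻¹) ⊔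
      ⁅L, (⊤ : Subgroup G)⁆ = ⊤ :=
    top_le_iff.1 (ht.ge.trans (sup_le (closure_le_closure_conj_sup t y) le_sup_right))
  have h2 := commutator_le_of_sup_central hL h1
  rwa [sup_eq_left.2 ((Subgroup.commutator_mono le_top le_rfl).trans h2)] at h1

/-- Lifting solutions through the quotient by the central subgroup `⁅L, G⁆`. -/
lemma exists_conjProd_eq_of_central [L.Normal] (hL : ⁅L, (⊤ : Subgroup G)⁆ ≤ Subgroup.center G)
    {t : Fin k → G} (ht : Subgroup.closure (Set.range t) ⊔ ⁅L, (⊤ : Subgroup G)⁆ = ⊤) {h : G}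
    (hh : h * (conjProd t 1)⁻¹ ∈ ⁅L, (⊤ : Subgroup G)⁆) :
    ∃ y : Fin k → G, conjProd t y = h ∧
      Subgroup.closure (Set.range fun j => y j * t j * (y j)⁻¹) = ⊤ := by
  obtain ⟨u, hu, hE⟩ := exists_conjProd_eq t
  have hB : ⁅L, ⁅L, (⊤ : Subgroup G)⁆⁆ ≤ (⊥ : Subgroup G) := by
    rw [Subgroup.commutator_comm, le_bot_iff, Subgroup.commutator_eq_bot_iff_le_centralizer]
    exact hL.trans (Subgroup.center_le_centralizer _)
  have hr := commProdHom_range hB _ (top_le_iff.1 (ht.ge.trans (sup_le_sup_right hu _)))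
  obtain ⟨y, hy⟩ : (QuotientGroup.mk' (⊥ : Subgroup G)) (h * (conjProd t 1)⁻¹) ∈
      (commProdHom hB fun j => u j * t j * (u j)⁻¹).range := by
    rw [hr]; exact ⟨_, hh, rfl⟩
  rw [commProdHom_apply] at hy
  replace hy : commProd (fun j => u j * t j * (u j)⁻¹) (fun j => (y j : G)) =
      h * (conjProd t 1)⁻¹ := QuotientGroup.quotientBot.symm.injective hy
  let Y : Fin k → L := fun j => ⟨(u j)⁻¹ * y j * u j, by
    simpa using Subgroup.Normal.conj_mem ‹L.Normal› (y j) (y j).2 (u j)⁻¹⟩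
  refine ⟨fun j => Y j, ?_, closure_conj_eq_top_of_central hL ht Y⟩
  have e : (fun j => u j * (Y j : G) * (u j)⁻¹) = fun j => (y j : G) := by
    funext j; simp [Y, mul_assoc]
  rw [hE, e, hy, inv_mul_cancel_right]

end Generation

section CentralizerMod

variable {G : Type*} [Group G]

/-- The elements of `L` that commute with `t` modulo `Z`. -/
def centralizerMod (Z L : Subgroup G) [Z.Normal] (t : G) : Subgroup L :=
  ((Subgroup.centralizer {(t : G ⧸ Z)}).comap (QuotientGroup.mk' Z)).subgroupOf L

variable {Z L : Subgroup G} [Z.Normal]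

lemma mem_centralizerMod {t : G} {y : L} : y ∈ centralizerMod Z L t ↔ ⁅(y : G), t⁆ ∈ Z := by
  rw [centralizerMod, Subgroup.mem_subgroupOf, Subgroup.mem_comap,
    Subgroup.mem_centralizer_singleton_iff, ← QuotientGroup.eq_one_iff]
  exact (commutatorElement_eq_one_iff_mul_comm (g₁ := ((y : G) : G ⧸ Z)) (g₂ := (t : G ⧸ Z))).symm

lemma index_centralizerMod_conj [L.Normal] (g t : G) :
    (centralizerMod Z L (g * t * g⁻¹)).index = (centralizerMod Z L t).index := by
  have e : centralizerMod Z L t =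
      (centralizerMod Z L (g * t * g⁻¹)).comap (MulAut.conjNormal g : L ≃* L).toMonoidHom := by
    ext y
    rw [Subgroup.mem_comap, mem_centralizerMod, mem_centralizerMod]
    have : ⁅(((MulAut.conjNormal g : L ≃* L).toMonoidHom y : L) : G), g * t * g⁻¹⁆ =
        g * ⁅(y : G), t⁆ * g⁻¹ := by
      rw [MulEquiv.coe_toMonoidHom, MulAut.conjNormal_apply, conjugate_commutatorElement]
    rw [this]
    exact ⟨fun h => Subgroup.Normal.conj_mem ‹_› _ h g, fun h => by
      simpa [mul_assoc] using Subgroup.Normal.conj_mem ‹Z.Normal› _ h g⁻¹⟩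
  rw [e]
  exact (Subgroup.index_comap_of_surjective _ (MulAut.conjNormal g : L ≃* L).surjective).symm

end CentralizerMod

section MinimalNoncentral

variable {G : Type*} [Group G] {L : Subgroup G}

lemma exists_commutatorElement_eq [L.Normal]
    (hLL : ⁅L, L⁆ ≤ Subgroup.center G) (hZL : Subgroup.center G ≤ L)
    (hmin : ∀ M : Subgroup G, M.Normal → Subgroup.center G ≤ M → M ≤ L →
      M = Subgroup.center G ∨ M = L) {c : G} (hcL : c ∈ L) (hc : c ∉ Subgroup.center G)
    {z : G} (hz : z ∈ ⁅L, L⁆) : ∃ a ∈ L, ⁅a, c⁆ = z := by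
  let F : L →* G := MonoidHom.mk' (fun a => ⁅(a : G), c⁆) fun a b =>
    commutatorElement_mul_left_of_central hLL b.2 hcL
  have hK : ∀ a ∈ L, ⁅a, c⁆ ∈ F.range := fun a ha => ⟨⟨a, ha⟩, rfl⟩
  have hKZ : F.range ≤ Subgroup.center G := by
    rintro _ ⟨a, rfl⟩
    exact hLL (Subgroup.commutator_mem_commutator a.2 hcL)
  have hKn : F.range.Normal := ⟨fun z hz g => by
    rw [conj_eq_of_mem_center (hKZ hz)]; exact hz⟩
  have hLn : (L.map (QuotientGroup.mk' F.range)).Normal :=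
    Subgroup.Normal.map ‹_› _ (QuotientGroup.mk'_surjective _)
  let M : Subgroup G := L ⊓
    (Subgroup.centralizer (L.map (QuotientGroup.mk' F.range) : Set (G ⧸ F.range))).comap
      (QuotientGroup.mk' F.range)
  have hmem : ∀ t, t ∈ M ↔ t ∈ L ∧ ∀ a ∈ L, ⁅a, t⁆ ∈ F.range := by
    intro t
    rw [Subgroup.mem_inf, Subgroup.mem_comap, Subgroup.mem_centralizer_iff]
    refine and_congr_right fun _ => ?_
    constructor
    · intro h a ha
      rw [← QuotientGroup.eq_one_iff]
      exact (commutatorElement_eq_one_iff_mul_comm (g₁ := (a : G ⧸ F.range))).2 (h _ ⟨a, ha, rfl⟩)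
    · rintro h _ ⟨a, ha, rfl⟩
      exact (commutatorElement_eq_one_iff_mul_comm (g₁ := (a : G ⧸ F.range))
        (g₂ := (t : G ⧸ F.range))).1 ((QuotientGroup.eq_one_iff ⁅a, t⁆).2 (h a ha))
  have hML : M = L := by
    refine (hmin M inferInstance (fun t ht => ?_) inf_le_left).resolve_left fun h => hc ?_
    · rw [hmem]
      refine ⟨hZL ht, fun a _ => ?_⟩
      rw [commutatorElement_eq_one_iff_mul_comm.2 (Subgroup.mem_center_iff.1 ht a)]
      exact F.range.one_mem
    · rw [← h, hmem]
      exact ⟨hcL, hK⟩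
  have hle : ⁅L, L⁆ ≤ F.range := by
    rw [Subgroup.commutator_le]
    intro a ha t ht
    exact ((hmem t).1 (hML.symm ▸ ht)).2 a ha
  obtain ⟨a, ha⟩ := hle hz
  exact ⟨a, a.2, ha⟩

lemma card_commutator_self_le [Finite G] [L.Normal]
    (hLL : ⁅L, L⁆ ≤ Subgroup.center G) (hZL : Subgroup.center G ≤ L)
    (hmin : ∀ M : Subgroup G, M.Normal → Subgroup.center G ≤ M → M ≤ L →
      M = Subgroup.center G ∨ M = L) {c : G} (hcL : c ∈ L) (hc : c ∉ Subgroup.center G) :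
    Nat.card (⁅L, L⁆ : Subgroup G) ≤ (Subgroup.center G).relIndex L := by
  let F : L →* G := MonoidHom.mk' (fun a => ⁅(a : G), c⁆) fun a b =>
    commutatorElement_mul_left_of_central hLL b.2 hcL
  have h1 : ⁅L, L⁆ ≤ F.range := by
    intro z hz
    obtain ⟨a, ha, h⟩ := exists_commutatorElement_eq hLL hZL hmin hcL hc hz
    exact ⟨⟨a, ha⟩, h⟩
  have h2 : (Subgroup.center G).subgroupOf L ≤ F.ker := by
    intro a ha
    rw [MonoidHom.mem_ker]
    exact commutatorElement_eq_one_iff_mul_comm.2 (Subgroup.mem_center_iff.1 ha c).symm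
  calc Nat.card (⁅L, L⁆ : Subgroup G) ≤ Nat.card F.range := Subgroup.card_le_of_le h1
    _ = F.ker.index := (Subgroup.index_ker F).symm
    _ ≤ ((Subgroup.center G).subgroupOf L).index := Subgroup.index_antitone h2

lemma card_commutator_top_le [Finite G] [L.Normal] {k : ℕ} (t : Fin k → G)
    (ht : Subgroup.closure (Set.range t) ⊔ ⁅L, (⊤ : Subgroup G)⁆ = ⊤) :
    Nat.card (⁅L, (⊤ : Subgroup G)⁆ : Subgroup G) ≤
      (Subgroup.center G).relIndex L ^ k * Nat.card (⁅L, L⁆ : Subgroup G) := by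
  have hNL : ⁅L, (⊤ : Subgroup G)⁆ ≤ L := Subgroup.commutator_le_left _ _
  have hB : ⁅L, ⁅L, (⊤ : Subgroup G)⁆⁆ ≤ ⁅L, L⁆ := Subgroup.commutator_mono le_rfl hNL
  have h1 : Subgroup.pi Set.univ (fun _ : Fin k => (Subgroup.center G).subgroupOf L) ≤
      (commProdHom hB t).ker := by
    intro y hy
    rw [MonoidHom.mem_ker, commProdHom_apply]
    have : commProd t (fun j => (y j : G)) = 1 := by
      refine List.prod_eq_one fun x hx => ?_
      obtain ⟨i, rfl⟩ := (List.mem_ofFn' _ _).1 hx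
      exact commutatorElement_eq_one_iff_mul_comm.2
        (Subgroup.mem_center_iff.1 (hy i trivial) (t i)).symm
    rw [this]; rfl
  have h2 := Subgroup.index_antitone h1
  rw [Subgroup.index_ker, commProdHom_range hB t ht, Subgroup.index_pi] at h2
  rw [← card_map_mk_mul_card (A := ⁅L, L⁆) (Subgroup.commutator_mono le_rfl le_top)]
  refine Nat.mul_le_mul_right _ (h2.trans_eq ?_)
  simp [Subgroup.relIndex]

lemma card_mul_prod_index_centralizerMod_le [Finite G] {Z : Subgroup G} [Z.Normal] {k : ℕ}
    (t : Fin k → G) (e : (Fin k → L) → Fin k → L)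
    (he : ∀ b b' i, (∀ j, i < j → b j = b' j) → e b i = e b' i) :
    Nat.card {b : Fin k → L | ∀ i, ⁅(b i : G), t i⁆ * (e b i : G) ∈ Z} *
      ∏ i, (centralizerMod Z L (t i)).index ≤ Nat.card L ^ k := by
  refine card_mul_prod_index_le _ _ fun b hb b' hb' i hi => ?_
  have h1 := hb i
  have h2 := hb' i
  rw [he b b' i hi] at h1
  have h3 := Z.mul_mem h2 (Z.inv_mem h1)
  rw [mem_centralizerMod]
  have e1 : (b' i : G) = b i * ((b i)⁻¹ * b' i : L) := by simp
  rw [e1, mul_commutatorElement, mul_inv_rev, mul_assoc, mul_inv_cancel_left,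
    mul_inv_cancel_right] at h3
  have h4 := Subgroup.Normal.conj_mem ‹Z.Normal› _ h3 (b i : G)⁻¹
  simpa [mul_assoc] using h4

/-- The subgroups supplementing `L` with intersection `Z`. -/
def relComplements (Z L : Subgroup G) : Set (Subgroup G) :=
  {C | C ⊔ L = ⊤ ∧ C ⊓ L = Z}

lemma card_relComplements_le [Finite G] [L.Normal] {Z : Subgroup G} [Z.Normal] {ι : Type*}
    [Finite ι]
    {φ : ι → G} (hφ : Subgroup.closure (Set.range φ) = ⊤) :
    Nat.card (relComplements Z L) ≤ Z.relIndex L ^ Nat.card ι := by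
  have hex : ∀ C : relComplements Z L, ∀ i, ∃ l : L, (φ i) * l ∈ C.1 := by
    intro C i
    have hi : φ i ∈ C.1 ⊔ L := by rw [show C.1 ⊔ L = ⊤ from C.2.1]; exact Subgroup.mem_top _
    obtain ⟨c, hc, l, hl, h⟩ := Subgroup.mem_sup_of_normal_right.1 hi
    refine ⟨⟨l⁻¹, L.inv_mem hl⟩, ?_⟩
    rw [← h]; simpa using hc
  choose l hl using hex
  have hZC : ∀ C : relComplements Z L, Z ≤ C.1 := fun C =>
    (show C.1 ⊓ L = Z from C.2.2).ge.trans inf_le_left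
  have hinj : Function.Injective fun (C : relComplements Z L) (i : ι) =>
      (QuotientGroup.mk (l C i) : L ⧸ Z.subgroupOf L) := by
    suffices H : ∀ C C' : relComplements Z L,
        (∀ i, (QuotientGroup.mk (l C i) : L ⧸ Z.subgroupOf L) =
        QuotientGroup.mk (l C' i)) → C.1 ≤ C'.1 from fun C C' h =>
      Subtype.ext ((H C C' (congrFun h)).antisymm (H C' C (congrFun h.symm)))
    intro C C' h
    have h1 : ∀ i, φ i * l C i ∈ C'.1 := by
      intro i
      have h2 : (l C' i)⁻¹ * l C i ∈ Z.subgroupOf L := QuotientGroup.eq.1 (h i).symm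
      have := C'.1.mul_mem (hl C' i) (hZC C' h2)
      simpa [mul_assoc] using this
    let W := C.1 ⊓ C'.1
    have hW : W ⊔ L = ⊤ := by
      rw [eq_top_iff, ← hφ, Subgroup.closure_le]
      rintro _ ⟨i, rfl⟩
      have : φ i = φ i * l C i * (l C i : G)⁻¹ := by simp
      rw [SetLike.mem_coe, this]
      exact Subgroup.mul_mem _ (Subgroup.mem_sup_left ⟨hl C i, h1 i⟩)
        (Subgroup.mem_sup_right (L.inv_mem (l C i).2))
    intro c hc
    obtain ⟨w, hw, x, hx, rfl⟩ := Subgroup.mem_sup_of_normal_right.1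
      (show c ∈ W ⊔ L from hW.symm ▸ Subgroup.mem_top c)
    have hxC : x ∈ C.1 := (Subgroup.mul_mem_cancel_left _ hw.1).1 hc
    have hxZ : x ∈ Z := C.2.2 ▸ (⟨hxC, hx⟩ : x ∈ C.1 ⊓ L)
    exact C'.1.mul_mem hw.2 (hZC C' hxZ)
  have := Fintype.ofFinite ι
  simpa [Nat.card_pi, Subgroup.relIndex, Subgroup.index] using
    Nat.card_le_card_of_injective _ hinj

lemma exists_relComplements [L.Normal] (hLL : ⁅L, L⁆ ≤ Subgroup.center G)
    (hZL : Subgroup.center G ≤ L)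
    (hmin : ∀ M : Subgroup G, M.Normal → Subgroup.center G ≤ M → M ≤ L →
      M = Subgroup.center G ∨ M = L) {k : ℕ} {t : Fin k → G}
    (ht : Subgroup.closure (Set.range t) ⊔ ⁅L, (⊤ : Subgroup G)⁆ = ⊤) (y : Fin k → L)
    (hy : Subgroup.closure (Set.range fun j => (y j : G) * t j * (y j : G)⁻¹) ≠ ⊤) :
    ∃ C ∈ relComplements (Subgroup.center G) L, ∀ j, (y j : G) * t j * (y j : G)⁻¹ ∈ C := by
  set H := Subgroup.closure (Set.range fun j => (y j : G) * t j * (y j : G)⁻¹) with hH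
  have hNL : ⁅L, (⊤ : Subgroup G)⁆ ≤ L := Subgroup.commutator_le_left _ _
  have hHN : H ⊔ ⁅L, (⊤ : Subgroup G)⁆ = ⊤ :=
    top_le_iff.1 (ht.ge.trans (sup_le (closure_le_closure_conj_sup t y) le_sup_right))
  set C := H ⊔ Subgroup.center G with hC
  have hCtop : C ≠ ⊤ := by
    intro h
    have h2 := commutator_le_of_sup_central le_rfl h
    rw [sup_eq_left.2 ((Subgroup.commutator_mono le_top le_rfl).trans h2)] at hHN
    exact hy hHN
  have hCL : C ⊔ L = ⊤ := top_le_iff.1 (hHN.ge.trans (sup_le_sup le_sup_left hNL))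
  have hZC : Subgroup.center G ≤ C := le_sup_right
  have hn : (C ⊓ L).Normal := by
    rw [← Subgroup.normalizer_eq_top_iff, eq_top_iff, ← hCL, sup_le_iff]
    have key : ∀ K : Subgroup G, (∀ g ∈ K, ∀ x ∈ C ⊓ L, g * x * g⁻¹ ∈ C ⊓ L) →
        K ≤ Subgroup.normalizer (C ⊓ L : Subgroup G) := by
      intro K hK g hg
      rw [Subgroup.mem_normalizer_iff]
      refine fun x => ⟨hK g hg x, fun hx => ?_⟩
      simpa [mul_assoc] using hK _ (K.inv_mem hg) _ hx
    refine ⟨key C fun g hg x hx => ⟨C.mul_mem (C.mul_mem hg hx.1) (C.inv_mem hg),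
      Subgroup.Normal.conj_mem ‹_› x hx.2 g⟩, key L fun g hg x hx => ?_⟩
    have : g * x * g⁻¹ = ⁅g, x⁆ * x := by simp [commutatorElement_def]
    refine ⟨?_, Subgroup.Normal.conj_mem ‹_› x hx.2 g⟩
    rw [this]
    exact C.mul_mem (hZC (hLL (Subgroup.commutator_mem_commutator hg hx.2))) hx.1
  refine ⟨C, ⟨hCL, (hmin _ hn (le_inf hZC hZL) inf_le_right).resolve_right fun h => ?_⟩,
    fun j => Subgroup.mem_sup_left (Subgroup.subset_closure ⟨j, rfl⟩)⟩
  rw [inf_eq_right] at h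
  rw [sup_eq_left.2 h] at hCL
  exact hCtop hCL

end MinimalNoncentral

section NoncentralLift

variable {G : Type*} [Group G] [Finite G] {L : Subgroup G} {k : ℕ}

lemma card_not_generating_mul_le [L.Normal] (hLL : ⁅L, L⁆ ≤ Subgroup.center G)
    (hZL : Subgroup.center G ≤ L)
    (hmin : ∀ M : Subgroup G, M.Normal → Subgroup.center G ≤ M → M ≤ L →
      M = Subgroup.center G ∨ M = L) {ι : Type*} [Finite ι]
    {φ : ι → G} (hφ : Subgroup.closure (Set.range φ) = ⊤) {t : Fin k → G}
    (ht : Subgroup.closure (Set.range t) ⊔ ⁅L, (⊤ : Subgroup G)⁆ = ⊤) :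
    Nat.card {y : Fin k → L |
        Subgroup.closure (Set.range fun j => (y j : G) * t j * (y j : G)⁻¹) ≠ ⊤} *
      ∏ i, (centralizerMod (Subgroup.center G) L (t i)).index ≤
      (Subgroup.center G).relIndex L ^ Nat.card ι * Nat.card L ^ k := by
  set Z := Subgroup.center G with hZ
  set R := ∏ i, (centralizerMod Z L (t i)).index
  have hC : ∀ C ∈ relComplements Z L,
      {y : Fin k → L | ∀ j, (y j : G) * t j * (y j : G)⁻¹ ∈ C}.ncard * R ≤ Nat.card L ^ k := by
    intro C hC
    refine card_mul_prod_index_le _ _ fun b hb b' hb' i _ => ?_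
    rw [mem_centralizerMod]
    have h1 := C.mul_mem (hb' i) (C.inv_mem (hb i))
    have h2 : (b' i : G) * t i * (b' i : G)⁻¹ * ((b i : G) * t i * (b i : G)⁻¹)⁻¹ =
        b i * ⁅((b i)⁻¹ * b' i : L).1, t i⁆ * (b i : G)⁻¹ := by
      simp only [commutatorElement_def, Subgroup.coe_mul, Subgroup.coe_inv]; group
    have h3 : (b i : G) * ⁅((b i)⁻¹ * b' i : L).1, t i⁆ * (b i : G)⁻¹ ∈ C ⊓ L :=
      ⟨h2 ▸ h1, Subgroup.Normal.conj_mem ‹_› _ (Subgroup.commutator_le_left L ⊤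
        (Subgroup.commutator_mem_commutator (SetLike.coe_mem _) (Subgroup.mem_top _))) _⟩
    rw [hC.2] at h3
    simpa [mul_assoc] using Subgroup.Normal.conj_mem (inferInstance : Z.Normal) _ h3 (b i : G)⁻¹
  have hfin : (relComplements Z L).Finite := Set.toFinite _
  have hsub : {y : Fin k → L |
        Subgroup.closure (Set.range fun j => (y j : G) * t j * (y j : G)⁻¹) ≠ ⊤} ⊆
      ⋃ C ∈ hfin.toFinset, {y : Fin k → L | ∀ j, (y j : G) * t j * (y j : G)⁻¹ ∈ C} := by
    intro y hy
    obtain ⟨C, hC, h⟩ := exists_relComplements hLL hZL hmin ht y hy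
    exact Set.mem_biUnion (hfin.mem_toFinset.2 hC) h
  have h1 := (Set.ncard_le_ncard hsub (Set.toFinite _)).trans
    (Finset.set_ncard_biUnion_le hfin.toFinset _)
  calc _ ≤ (∑ C ∈ hfin.toFinset,
        {y : Fin k → L | ∀ j, (y j : G) * t j * (y j : G)⁻¹ ∈ C}.ncard) * R :=
        Nat.mul_le_mul_right _ h1
    _ ≤ ∑ C ∈ hfin.toFinset, Nat.card L ^ k := by
        rw [Finset.sum_mul]
        exact Finset.sum_le_sum fun C h => hC C (hfin.mem_toFinset.1 h)
    _ = Nat.card (relComplements Z L) * Nat.card L ^ k := by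
        rw [Finset.sum_const, smul_eq_mul, ← Set.ncard_eq_toFinset_card _ hfin]; rfl
    _ ≤ _ := Nat.mul_le_mul_right _ (card_relComplements_le hφ)

lemma lt_sq_sub_of_pow_le {q n a : ℕ} {X R s b : ℝ} (hq : 2 ≤ q) (hX : 0 < X)
    (hR : (q : ℝ) ^ (2 * a + 6) ≤ R) (hn : 0 < n) (hnq : n ≤ q ^ (a + 1))
    (hs : s * R ≤ q ^ a * X) (hb : b * R ≤ X) : b * X < (X / n - s) ^ 2 := by
  have hq0 : (2 : ℝ) ≤ q := by exact_mod_cast hq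
  have hqp : (0 : ℝ) < (q : ℝ) ^ a := by positivity
  have hR0 : 0 < R := lt_of_lt_of_le (by positivity) hR
  set w : ℝ := X / q ^ (a + 3) with hw
  have hw0 : 0 < w := by positivity
  have h1 : b * X ≤ w ^ 2 := by
    have : b ≤ X / (q : ℝ) ^ (2 * a + 6) := by
      rw [le_div_iff₀ (by positivity)]
      by_cases hb0 : 0 ≤ b
      · exact (mul_le_mul_of_nonneg_left hR hb0).trans hb
      · exact (mul_nonpos_of_nonpos_of_nonneg (not_le.1 hb0).le (by positivity)).trans hX.le
    calc b * X ≤ X / (q : ℝ) ^ (2 * a + 6) * X := mul_le_mul_of_nonneg_right this hX.le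
      _ = w ^ 2 := by rw [hw]; field_simp; ring
  have h2 : s ≤ w := by
    have h3 : s ≤ (q : ℝ) ^ a * X / R := by rwa [le_div_iff₀ hR0]
    refine h3.trans ((div_le_div_of_nonneg_left (by positivity) (by positivity) hR).trans ?_)
    rw [hw, div_le_div_iff₀ (by positivity) (by positivity)]
    have : (q : ℝ) ^ (a + 3) * q ^ a ≤ q ^ (2 * a + 6) := by
      rw [← pow_add]; exact pow_le_pow_right₀ (by linarith) (by omega)
    nlinarith
  have h3 : 4 * w ≤ X / n := by
    have : X / (q : ℝ) ^ (a + 1) ≤ X / n :=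
      div_le_div_of_nonneg_left hX.le (by positivity) (by exact_mod_cast hnq)
    refine le_trans ?_ this
    have e : X / (q : ℝ) ^ (a + 1) = (q : ℝ) ^ 2 * w := by rw [hw]; field_simp; ring
    rw [e]
    have : (4 : ℝ) ≤ (q : ℝ) ^ 2 := by nlinarith
    exact mul_le_mul_of_nonneg_right this hw0.le
  nlinarith

lemma exists_conjProd_eq_of_noncentral [L.Normal] (hLL : ⁅L, L⁆ ≤ Subgroup.center G)
    (hZL : Subgroup.center G ≤ L)
    (hmin : ∀ M : Subgroup G, M.Normal → Subgroup.center G ≤ M → M ≤ L →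
      M = Subgroup.center G ∨ M = L) (hL : ¬ L ≤ Subgroup.center G) {ι : Type*} [Finite ι]
    {φ : ι → G} (hφ : Subgroup.closure (Set.range φ) = ⊤) {t : Fin k → G}
    (ht : Subgroup.closure (Set.range t) ⊔ ⁅L, (⊤ : Subgroup G)⁆ = ⊤)
    (hidx : (Subgroup.center G).relIndex L ^ (2 * Nat.card ι + 6) ≤
      ∏ i, (centralizerMod (Subgroup.center G) L (t i)).index) {h : G}
    (hh : h * (conjProd t 1)⁻¹ ∈ ⁅L, (⊤ : Subgroup G)⁆) :
    ∃ y : Fin k → G, conjProd t y = h ∧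
      Subgroup.closure (Set.range fun j => y j * t j * (y j)⁻¹) = ⊤ := by
  by_contra hcon
  push Not at hcon
  obtain ⟨c, hcL, hc⟩ := SetLike.not_le_iff_exists.1 hL
  set Z := Subgroup.center G with hZ
  set q := Z.relIndex L with hq
  have hq2 : 2 ≤ q := by
    have h0 : q ≠ 0 := Subgroup.FiniteIndex.index_ne_zero
    have h1 : q ≠ 1 := fun h => hL (Subgroup.relIndex_eq_one.1 h)
    omega
  obtain ⟨u, hu, hE⟩ := exists_conjProd_eq t
  set τ : Fin k → G := fun j => u j * t j * (u j)⁻¹ with hτ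
  have hτtop : Subgroup.closure (Set.range τ) ⊔ ⁅L, (⊤ : Subgroup G)⁆ = ⊤ :=
    top_le_iff.1 (ht.ge.trans (sup_le_sup_right hu _))
  have hNL : ⁅L, (⊤ : Subgroup G)⁆ ≤ L := Subgroup.commutator_le_left _ _
  have hcomm : ∀ (y : L) (g : G), ⁅(y : G), g⁆ ∈ L := fun y g =>
    hNL (Subgroup.commutator_mem_commutator y.2 (Subgroup.mem_top g))
  have hB : ⁅L, ⁅L, (⊤ : Subgroup G)⁆⁆ ≤ ⁅L, L⁆ := Subgroup.commutator_mono le_rfl hNL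
  obtain ⟨e, he, hmul⟩ := exists_commProd_mul hLL τ
  let d : (Fin k → L) → Fin k → G := fun b j => ⁅(b j : G), τ j⁆ * (e b j : G)
  have hd : ∀ b j, d b j ∈ L := fun b j => L.mul_mem (hcomm _ _) (e b j).2
  have hmoment := sq_sub_card_fiber_le (N := ⁅L, (⊤ : Subgroup G)⁆) (A := ⁅L, L⁆)
    (Subgroup.commutator_mono le_rfl le_top) hLL
    (fun y : Fin k → L => commProd τ fun j => (y j : G))
    (fun a b => commProd (d b) fun j => (a j : G)) hmul
    (fun a b => Subgroup.list_prod_mem _ fun x hx => by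
      obtain ⟨i, rfl⟩ := (List.mem_ofFn' _ _).1 hx
      exact Subgroup.commutator_mem_commutator (a i).2 (hd b i))
    (fun a a' b => by
      simp only [commProd]
      rw [← List.prod_ofFn_mul_of_commute]
      · congr 2
        funext j
        exact commutatorElement_mul_left_of_central hLL (a' j).2 (hd b j)
      · exact fun i j => (Subgroup.mem_center_iff.1
          (hLL (Subgroup.commutator_mem_commutator (a' _).2 (hd b _))) _))
    {b | ∀ i, d b i ∈ Z}
    (fun b hb z hz => by
      simp only [Set.mem_ofPred_eq, not_forall] at hb
      obtain ⟨i, hi⟩ := hb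
      obtain ⟨a, haL, ha⟩ := exists_commutatorElement_eq hLL hZL hmin (hd b i) hi hz
      refine ⟨Pi.mulSingle i ⟨a, haL⟩, ?_⟩
      have : (fun j => ((Pi.mulSingle i ⟨a, haL⟩ : Fin k → L) j : G)) = Pi.mulSingle i a := by
        funext j
        by_cases hj : j = i
        · subst hj; simp
        · rw [Pi.mulSingle_eq_of_ne hj, Pi.mulSingle_eq_of_ne hj, Subgroup.coe_one]
      rw [this, commProd_mulSingle, ha])
    (commProdHom hB τ) (fun x => rfl) (commProdHom_range hB τ hτtop) hh
  have hbad := card_mul_prod_index_centralizerMod_le (Z := Z) τ e he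
  have hRτ : ∏ i, (centralizerMod Z L (τ i)).index = ∏ i, (centralizerMod Z L (t i)).index :=
    Finset.prod_congr rfl fun i _ => index_centralizerMod_conj _ _
  rw [hRτ] at hbad
  have hgen := card_not_generating_mul_le hLL hZL hmin hφ ht
  have hs : Nat.card {y : Fin k → L // commProd τ (fun j => (y j : G)) = h * (conjProd t 1)⁻¹} ≤
      Nat.card {y : Fin k → L |
        Subgroup.closure (Set.range fun j => (y j : G) * t j * (y j : G)⁻¹) ≠ ⊤} := by
    let Y : (Fin k → L) → Fin k → L := fun y j => ⟨(u j)⁻¹ * y j * u j, by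
      simpa using Subgroup.Normal.conj_mem ‹L.Normal› (y j) (y j).2 (u j)⁻¹⟩
    have hY : Function.Injective Y := fun y y' hyy => by
      funext j
      simpa [Y] using congrFun hyy j
    refine Nat.card_le_card_of_injective (fun y => ⟨Y y.1, hcon _ ?_⟩) fun y y' hyy =>
      Subtype.ext (hY (congrArg Subtype.val hyy))
    have e : (fun j => u j * (Y y.1 j : G) * (u j)⁻¹) = fun j => (y.1 j : G) := by
      funext j; simp [Y, mul_assoc]
    rw [hE, e, y.2, inv_mul_cancel_right]
  have hN : Nat.card (⁅L, (⊤ : Subgroup G)⁆ : Subgroup G) ≤ q ^ (Nat.card ι + 1) := by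
    let g : Fin (Nat.card ι) → G := φ ∘ (Finite.equivFin ι).symm
    have hg : Subgroup.closure (Set.range g) = ⊤ := by
      rw [(Finite.equivFin ι).symm.surjective.range_comp, hφ]
    rw [pow_succ]
    exact (card_commutator_top_le g (by rw [hg, top_sup_eq])).trans
      (Nat.mul_le_mul_left _ (card_commutator_self_le hLL hZL hmin hcL hc))
  have hX : Nat.card (Fin k → L) = Nat.card L ^ k := by simp [Nat.card_pi]
  refine absurd hmoment (not_le.2 (lt_sq_sub_of_pow_le
    (R := ((∏ i, (centralizerMod Z L (t i)).index : ℕ) : ℝ)) hq2 ?_ ?_ Nat.card_pos hN ?_ ?_))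
  · exact_mod_cast Nat.card_pos
  · exact_mod_cast hidx
  · rw [hX]
    exact_mod_cast (Nat.mul_le_mul_right _ hs).trans hgen
  · rw [hX]
    exact_mod_cast hbad

end NoncentralLift

lemma closure_sup_eq_top_of_map {G : Type*} [Group G] {N : Subgroup G} [N.Normal] {k : ℕ}
    {t : Fin k → G}
    (h : Subgroup.closure (Set.range fun j => (t j : G ⧸ N)) = ⊤) :
    Subgroup.closure (Set.range t) ⊔ N = ⊤ := by
  have e : (Set.range fun j => (t j : G ⧸ N)) = QuotientGroup.mk' N '' Set.range t :=
    Set.range_comp (QuotientGroup.mk' N) t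
  rw [e, ← MonoidHom.map_closure] at h
  rw [← QuotientGroup.ker_mk' N, ← Subgroup.comap_map_eq, h, Subgroup.comap_top]

section SolvableInduction

variable {P G : Type*} [Group P] [Group G] [Finite G]

lemma relIndex_le_prod_index_relator [Fintype P] (hP : commutator P = ⊤) [Group.IsSolvable G]
    {φ : P → G} (hφ : Subgroup.closure (Set.range φ) = ⊤) {L : Subgroup G} [L.Normal]
    (hZL : Subgroup.center G ≤ L)
    (hmin : ∀ M : Subgroup G, M.Normal → Subgroup.center G ≤ M → M ≤ L →
      M = Subgroup.center G ∨ M = L) (hL : ¬ ⁅L, (⊤ : Subgroup G)⁆ ≤ Subgroup.center G) :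
    (Subgroup.center G).relIndex L ≤
      ∏ q, (centralizerMod (Subgroup.center G) L (relator φ q)).index := by
  refine le_trans (Subgroup.index_antitone ?_) (Subgroup.index_iInf_le _)
  intro v hv
  rw [Subgroup.mem_iInf] at hv
  rw [Subgroup.mem_subgroupOf]
  by_contra hvZ
  set Z := Subgroup.center G with hZ
  set π := QuotientGroup.mk' Z with hπ
  have hsurj : Function.Surjective π := QuotientGroup.mk'_surjective Z
  have hker : π.ker = Z := QuotientGroup.ker_mk' Z
  have : (L.map π).Normal := Subgroup.Normal.map ‹_› _ hsurj
  refine hL ?_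
  have h := le_center_of_commute_relator hP (φ := π ∘ φ) (L := L.map π) (v := π v) ?_ ?_
    ⟨v, v.2, rfl⟩ (fun h => hvZ (by rwa [← MonoidHom.mem_ker, hker] at h)) ?_
  · rw [Subgroup.commutator_le]
    intro l hl g _
    rw [← hker, MonoidHom.mem_ker, map_commutatorElement, commutatorElement_eq_one_iff_mul_comm]
    exact (Subgroup.mem_center_iff.1 (h ⟨l, hl, rfl⟩) (π g)).symm
  · rw [Set.range_comp, ← MonoidHom.map_closure, hφ, Subgroup.map_top_of_surjective _ hsurj]
  · intro M hM hML
    have h1 : M.comap π ≤ L := by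
      refine (Subgroup.comap_mono hML).trans_eq ?_
      rw [Subgroup.comap_map_eq, hker, sup_eq_left.2 hZL]
    have h2 : Z ≤ M.comap π := by
      exact hker.ge.trans (MonoidHom.ker_le_comap _ _)
    rw [← Subgroup.map_comap_eq_self_of_surjective hsurj M]
    refine (hmin _ (hM.comap π) h2 h1).imp (fun h => ?_) fun h => by rw [h]
    rw [h, Subgroup.map_eq_bot_iff, hker]
  · intro q
    rw [← map_relator, ← commutatorElement_eq_one_iff_commute, ← map_commutatorElement,
      ← MonoidHom.mem_ker, hker, ← inv_mem_iff, commutatorElement_inv]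
    exact mem_centralizerMod.1 (hv q)

lemma pow_relIndex_le_prod_index [Finite P] (hP : commutator P = ⊤) [Group.IsSolvable G]
    {φ : P → G} (hφ : Subgroup.closure (Set.range φ) = ⊤) {L : Subgroup G} [L.Normal]
    (hZL : Subgroup.center G ≤ L)
    (hmin : ∀ M : Subgroup G, M.Normal → Subgroup.center G ≤ M → M ≤ L →
      M = Subgroup.center G ∨ M = L) (hL : ¬ ⁅L, (⊤ : Subgroup G)⁆ ≤ Subgroup.center G)
    {k m : ℕ} {s : Fin k → G} (e : Fin m × (P × P) ↪ Fin k)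
    (he : ∀ z, s (e z) = relator φ z.2) :
    (Subgroup.center G).relIndex L ^ m ≤
      ∏ i, (centralizerMod (Subgroup.center G) L (s i)).index := by
  have := Fintype.ofFinite P
  calc (Subgroup.center G).relIndex L ^ m
      ≤ (∏ q, (centralizerMod (Subgroup.center G) L (relator φ q)).index) ^ m :=
        Nat.pow_le_pow_left (relIndex_le_prod_index_relator hP hφ hZL hmin hL) m
    _ = ∏ i ∈ Finset.univ.map e, (centralizerMod (Subgroup.center G) L (s i)).index := by
        rw [Finset.prod_map]
        simp only [he, Fintype.prod_prod_type (α₁ := Fin m), Finset.prod_const, Finset.card_univ,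
          Fintype.card_fin]
    _ ≤ _ := Finset.prod_le_prod_of_subset_of_one_le' (Finset.subset_univ _) fun i _ _ =>
        Nat.one_le_iff_ne_zero.2 Subgroup.FiniteIndex.index_ne_zero

lemma exists_minimal_noncentral [Group.IsSolvable G] (hG : commutator G ≠ ⊥) :
    ∃ L : Subgroup G, L.Normal ∧ Subgroup.center G ≤ L ∧ ¬ L ≤ Subgroup.center G ∧
      (∀ M : Subgroup G, M.Normal → Subgroup.center G ≤ M → M ≤ L →
        M = Subgroup.center G ∨ M = L) ∧ ⁅L, L⁆ ≤ Subgroup.center G := by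
  have hne : Subgroup.center G ≠ ⊤ := fun h => hG ((commutator_eq_bot_iff_center_eq_top G).2 h)
  obtain ⟨L, ⟨hLn, hZL⟩, hLmin⟩ := (Set.toFinite
    {L : Subgroup G | L.Normal ∧ Subgroup.center G < L}).exists_minimal
      ⟨⊤, inferInstance, lt_top_iff_ne_top.2 hne⟩
  have hmin : ∀ M : Subgroup G, M.Normal → Subgroup.center G ≤ M → M ≤ L →
      M = Subgroup.center G ∨ M = L := by
    intro M hM hZM hML
    rcases hZM.eq_or_lt with h | h
    · exact .inl h.symm
    · exact .inr (hML.antisymm (hLmin ⟨hM, h⟩ hML))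
  refine ⟨L, hLn, hZL.le, not_le_of_gt hZL, hmin, ?_⟩
  have hLL : ⁅L, L⁆ ≤ L := Subgroup.commutator_le_left _ _
  rcases hmin (⁅L, L⁆ ⊔ Subgroup.center G) inferInstance le_sup_right (sup_le hLL hZL.le) with h | h
  · exact sup_eq_right.1 h
  · exfalso
    set π := QuotientGroup.mk' (Subgroup.center G) with hπ
    have hker : π.ker = Subgroup.center G := QuotientGroup.ker_mk' _
    have h1 : L.map π ≠ ⊥ := by
      rw [Ne, Subgroup.map_eq_bot_iff, hker]
      exact not_le_of_gt hZL
    refine (Group.IsSolvable.commutator_lt_of_ne_bot h1).ne ?_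
    rw [← Subgroup.map_commutator]
    conv_rhs => rw [← h, Subgroup.map_sup]
    rw [(Subgroup.map_eq_bot_iff (Subgroup.center G)).2 hker.ge, sup_bot_eq]

end SolvableInduction

/-- Solving `h = ∏ xⱼ sⱼ xⱼ⁻¹` in a finite solvable group `G` generated by the image of a map `φ`
from a finite perfect group, where `s` contains sufficiently many copies of every relator. -/
theorem exists_conjProd_eq_of_isSolvable {P : Type*} [Group P] [Finite P] (hP : commutator P = ⊤)
    {k : ℕ} (e : Fin (2 * Nat.card P + 6) × (P × P) ↪ Fin k) (n : ℕ) :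
    ∀ (G : Type*) [Group G] [Finite G] [Group.IsSolvable G] (φ : P → G) (s : Fin k → G) (h : G),
      Nat.card G = n → Subgroup.closure (Set.range φ) = ⊤ → (∀ z, s (e z) = relator φ z.2) →
      Subgroup.closure (Set.range s) ⊔ commutator G = ⊤ → h * (conjProd s 1)⁻¹ ∈ commutator G →
      ∃ x : Fin k → G, conjProd s x = h ∧
        Subgroup.closure (Set.range fun j => x j * s j * (x j)⁻¹) = ⊤ := by
  induction n using Nat.strong_induction_on with
  | _ n ih =>
  intro G _ _ _ φ s h hn hφ he hs hh
  by_cases hG : commutator G = ⊥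
  · refine ⟨1, ?_, by simpa [hG] using hs⟩
    rw [hG, Subgroup.mem_bot, mul_inv_eq_one] at hh
    exact hh.symm
  have reduce : ∀ L : Subgroup G, L.Normal → ⁅L, (⊤ : Subgroup G)⁆ ≠ ⊥ → ∃ x : Fin k → G,
      Subgroup.closure (Set.range fun j => x j * s j * (x j)⁻¹) ⊔ ⁅L, (⊤ : Subgroup G)⁆ = ⊤ ∧
      h * (conjProd (fun j => x j * s j * (x j)⁻¹) 1)⁻¹ ∈ ⁅L, (⊤ : Subgroup G)⁆ := by
    intro L _ hL
    set N := ⁅L, (⊤ : Subgroup G)⁆ with hN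
    set π := QuotientGroup.mk' N with hπ
    have hsurj : Function.Surjective π := QuotientGroup.mk'_surjective N
    have hcard : Nat.card (G ⧸ N) < n := by
      have h1 := Subgroup.card_eq_card_quotient_mul_card_subgroup N
      have h2 := Subgroup.one_lt_card_iff_ne_bot N |>.2 hL
      have h3 : 0 < Nat.card (G ⧸ N) := Nat.card_pos
      nlinarith
    have hcomm : commutator (G ⧸ N) = (commutator G).map π := by
      rw [commutator_def, commutator_def, Subgroup.map_commutator,
        Subgroup.map_top_of_surjective _ hsurj]
    obtain ⟨x', hx', hgen⟩ := ih _ hcard (G ⧸ N) (π ∘ φ) (π ∘ s) (π h) rfl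
      (by rw [Set.range_comp, ← MonoidHom.map_closure, hφ,
        Subgroup.map_top_of_surjective _ hsurj])
      (fun z => by rw [← map_relator, ← he]; rfl)
      (by rw [Set.range_comp, ← MonoidHom.map_closure, hcomm, ← Subgroup.map_sup, hs,
        Subgroup.map_top_of_surjective _ hsurj])
      (by
        rw [hcomm]
        refine ⟨_, hh, ?_⟩
        rw [map_mul, map_inv, map_conjProd]
        rfl)
    choose x hx using fun j => hsurj (x' j)
    refine ⟨x, closure_sup_eq_top_of_map ?_, ?_⟩
    · rw [← hgen]
      congr 2
      funext j
      rw [← hx]; rfl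
    · rw [conjProd_conj, ← QuotientGroup.ker_mk' N, MonoidHom.mem_ker, map_mul, map_inv,
        map_conjProd, mul_inv_eq_one, ← hπ, ← hx']
      congr 1
      funext j
      simp [hx]
  have lift : ∀ x : Fin k → G, (∃ y : Fin k → G,
      conjProd (fun j => x j * s j * (x j)⁻¹) y = h ∧
      Subgroup.closure (Set.range fun j => y j * (x j * s j * (x j)⁻¹) * (y j)⁻¹) = ⊤) →
      ∃ x : Fin k → G, conjProd s x = h ∧
        Subgroup.closure (Set.range fun j => x j * s j * (x j)⁻¹) = ⊤ := by
    rintro x ⟨y, hy, hgen⟩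
    refine ⟨fun j => y j * x j, by rw [← conjProd_conj, hy], ?_⟩
    rw [← hgen]
    congr 2
    funext j
    group
  by_cases hC : ∃ L : Subgroup G, L.Normal ∧ ⁅L, (⊤ : Subgroup G)⁆ ≤ Subgroup.center G ∧
      ⁅L, (⊤ : Subgroup G)⁆ ≠ ⊥
  · obtain ⟨L, hLn, hLc, hL⟩ := hC
    obtain ⟨x, hx, hxh⟩ := reduce L hLn hL
    exact lift x (exists_conjProd_eq_of_central hLc hx hxh)
  push Not at hC
  obtain ⟨L, hLn, hZL, hLZ, hmin, hLL⟩ := exists_minimal_noncentral hG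
  have hne : ⁅L, (⊤ : Subgroup G)⁆ ≠ ⊥ := by
    intro h
    rw [Subgroup.commutator_eq_bot_iff_le_centralizer, Subgroup.coe_top,
      Subgroup.centralizer_univ] at h
    exact hLZ h
  have hnc : ¬ ⁅L, (⊤ : Subgroup G)⁆ ≤ Subgroup.center G := fun h => hne (hC L hLn h)
  obtain ⟨x, hx, hxh⟩ := reduce L hLn hne
  refine lift x (exists_conjProd_eq_of_noncentral hLL hZL hmin hLZ hφ hx ?_ hxh)
  simp only [index_centralizerMod_conj]
  exact pow_relIndex_le_prod_index hP hφ hZL hmin hnc e he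

section SignedRelators

lemma exists_list_of_mem_subgroup_closure {G : Type*} [Group G] {S : Set G} {x : G}
    (hx : x ∈ Subgroup.closure S) : ∃ l : List G, (∀ y ∈ l, y ∈ S ∨ y⁻¹ ∈ S) ∧ l.prod = x := by
  rw [← Subgroup.mem_toSubmonoid, Subgroup.closure_toSubmonoid] at hx
  exact Submonoid.exists_list_of_mem_closure hx

variable {P : Type*} [Group P]

lemma mem_closure_relator_sup_commutator (hP : commutator P = ⊤) (w : FreeGroup P) :
    w ∈ Subgroup.closure (Set.range (relator (FreeGroup.of : P → FreeGroup P))) ⊔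
      commutator (FreeGroup P) := by
  set W := Subgroup.closure (Set.range (relator (FreeGroup.of : P → FreeGroup P))) ⊔
      commutator (FreeGroup P) with hW
  have hWn : W.Normal := ⟨fun x hx g => by
    have h : ⁅g, x⁆ ∈ W := Subgroup.mem_sup_right
      (Subgroup.commutator_mem_commutator (Subgroup.mem_top g) (Subgroup.mem_top x))
    simpa [commutatorElement_def] using W.mul_mem h hx⟩
  have hcomm : ∀ a b : FreeGroup P ⧸ W, a * b = b * a := by
    rintro ⟨a⟩ ⟨b⟩
    refine (commutatorElement_eq_one_iff_mul_comm (g₁ := (a : FreeGroup P ⧸ W))).1 ?_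
    exact (QuotientGroup.eq_one_iff ⁅a, b⁆).2 (Subgroup.mem_sup_right
      (Subgroup.commutator_mem_commutator (Subgroup.mem_top a) (Subgroup.mem_top b)))
  have : Group.IsSolvable (FreeGroup P ⧸ W) := Group.isSolvable_of_comm hcomm
  let f : P →* FreeGroup P ⧸ W := MonoidHom.mk' (fun p => (FreeGroup.of p : FreeGroup P ⧸ W)) <| by
    intro a b
    rw [← QuotientGroup.mk_mul, QuotientGroup.eq]
    exact Subgroup.mem_sup_left (Subgroup.subset_closure ⟨(a, b), rfl⟩)
  have hof : ∀ p, FreeGroup.of p ∈ W := fun p =>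
    (QuotientGroup.eq_one_iff _).1 (eq_one_of_commutator_eq_top hP f p)
  have htop : (⊤ : Subgroup (FreeGroup P)) ≤ W := by
    rw [← FreeGroup.closure_range_of, Subgroup.closure_le]
    rintro _ ⟨p, rfl⟩
    exact hof p
  exact htop trivial

/-- Every element of a finite perfect group is, modulo commutators of the free group, a product of
relators and inverses of relators in which all relators occur at least `m` times. -/
lemma exists_signedRelators [Finite P] (hP : commutator P = ⊤) {m : ℕ} (hm : 0 < m) (p : P) :
    ∃ (k : ℕ) (e : Fin m × (P × P) ↪ Fin k) (s : Fin k → FreeGroup P),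
      (∀ z, s (e z) = relator FreeGroup.of z.2) ∧
      (∀ j, ∃ q, s j = relator FreeGroup.of q ∨ (s j)⁻¹ = relator FreeGroup.of q) ∧
      FreeGroup.of p * (conjProd s 1)⁻¹ ∈ commutator (FreeGroup P) ∧
      Subgroup.closure (Set.range s) ⊔ commutator (FreeGroup P) = ⊤ := by
  let ε := Finite.equivFin (Fin m × (P × P))
  let a : Fin (Nat.card (Fin m × (P × P))) → FreeGroup P :=
    fun i => relator FreeGroup.of (ε.symm i).2
  obtain ⟨w, hw, c, hc, hwc⟩ := Subgroup.mem_sup_of_normal_right.1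
    (mem_closure_relator_sup_commutator hP ((List.ofFn a).prod⁻¹ * FreeGroup.of p))
  obtain ⟨l, hl, rfl⟩ := exists_list_of_mem_subgroup_closure hw
  let s : Fin (Nat.card (Fin m × (P × P)) + l.length) → FreeGroup P := Fin.append a l.get
  have hse : ∀ z, s (Fin.castAdd l.length (ε z)) = relator FreeGroup.of z.2 := by
    intro z; simp [s, a]
  refine ⟨_, ⟨fun z => Fin.castAdd l.length (ε z), fun z z' h => by simpa using h⟩, s, hse,
    fun j => ?_, ?_, ?_⟩
  · refine Fin.addCases (fun i => ?_) (fun i => ?_) j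
    · exact ⟨(ε.symm i).2, .inl (by simp [s, a])⟩
    · have : s (Fin.natAdd _ i) = l.get i := by simp [s]
      rw [this]
      rcases hl _ (l.get_mem i) with ⟨q, h⟩ | ⟨q, h⟩
      · exact ⟨q, .inl h.symm⟩
      · exact ⟨q, .inr h.symm⟩
  · have e1 : conjProd s 1 = (List.ofFn a).prod * l.prod := by
      have : conjProd s 1 = (List.ofFn s).prod := by simp [conjProd]
      rw [this, List.ofFn_fin_append, List.prod_append]
      simp
    have e2 : FreeGroup.of p = (List.ofFn a).prod * (l.prod * c) := by
      rw [hwc, mul_inv_cancel_left]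
    rw [e1, e2, ← mul_assoc]
    exact Subgroup.Normal.conj_mem inferInstance _ hc _
  · refine top_le_iff.1 fun w _ => ?_
    have hle : Subgroup.closure (Set.range (relator (FreeGroup.of : P → FreeGroup P))) ≤
        Subgroup.closure (Set.range s) := by
      rw [Subgroup.closure_le]
      rintro _ ⟨q, rfl⟩
      exact Subgroup.subset_closure ⟨_, hse (⟨0, hm⟩, q)⟩
    have hsup := sup_le_sup_right hle (commutator (FreeGroup P))
    exact hsup (mem_closure_relator_sup_commutator hP w)

end SignedRelators

section BiInvariant

variable {G : Type*} [Group G] {d : G → G → ℝ}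

lemma IsBiInvMetric.dist_one_mul_le (hd : IsBiInvMetric d) (g h : G) :
    d 1 (g * h) ≤ d 1 g + d 1 h := by
  obtain ⟨-, -, htri, hl, -⟩ := hd
  have := hl g 1 h
  rw [mul_one] at this
  rw [← this]
  exact htri _ _ _

lemma IsBiInvMetric.dist_one_inv (hd : IsBiInvMetric d) (g : G) : d 1 g⁻¹ = d 1 g := by
  obtain ⟨-, hsymm, -, hl, -⟩ := hd
  have := hl g 1 g⁻¹
  rw [mul_one, mul_inv_cancel] at this
  rw [← this, hsymm]

lemma IsBiInvMetric.dist_one_conj (hd : IsBiInvMetric d) (x g : G) :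
    d 1 (x * g * x⁻¹) = d 1 g := by
  obtain ⟨-, -, -, hl, hr⟩ := hd
  have h1 := hr x⁻¹ (x * 1) (x * g)
  rwa [hl, mul_one, mul_inv_cancel] at h1

lemma IsBiInvMetric.dist_one_conjProd_le (hd : IsBiInvMetric d) {ε : ℝ} {k : ℕ} (s x : Fin k → G)
    (hs : ∀ j, d 1 (s j) ≤ ε) : d 1 (conjProd s x) ≤ k * ε := by
  induction k with
  | zero => simp [conjProd, (hd.1 1 1).2 rfl]
  | succ k ih =>
    rw [conjProd_succ]
    refine (hd.dist_one_mul_le _ _).trans ?_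
    rw [hd.dist_one_conj]
    have := ih (fun j => s j.succ) (fun j => x j.succ) fun j => hs _
    have := hs 0
    push_cast
    linarith

lemma IsBiInvMetric.dist_one_relator (hd : IsBiInvMetric d) {P : Type*} [Group P] (φ : P → G)
    (q : P × P) : d 1 (relator φ q) = d (φ q.1 * φ q.2) (φ (q.1 * q.2)) := by
  obtain ⟨-, hsymm, -, hl, -⟩ := hd
  have := hl (φ (q.1 * q.2)) 1 (relator φ q)
  rw [← this, hsymm, relator, mul_inv_cancel_left, mul_one]

lemma isBiInvMetric_discrete [DecidableEq G] :
    IsBiInvMetric fun g h : G => if g = h then (0 : ℝ) else 1 := by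
  refine ⟨fun g h => by simp, fun g h => by simp only [eq_comm], fun g h k => ?_,
    fun g h k => by simp, fun g h k => by simp⟩
  dsimp only
  split_ifs <;> simp_all

end BiInvariant

/-- A uniform bound: almost multiplicative maps from a perfect group to a finite solvable group with
a bi-invariant metric are almost trivial. -/
lemma exists_forall_dist_one_le {P : Type*} [Group P] [Finite P] (hP : commutator P = ⊤) (p : P) :
    ∃ k : ℕ, ∀ (G : Type) [Group G] [Finite G] [Group.IsSolvable G] (d : G → G → ℝ) (φ : P → G)
      (ε : ℝ), IsBiInvMetric d → (∀ g h, d (φ g * φ h) (φ (g * h)) ≤ ε) → d 1 (φ p) ≤ k * ε := by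
  obtain ⟨k, e, s, hse, hsr, hsp, hs⟩ :=
    exists_signedRelators hP (m := 2 * Nat.card P + 6) (by omega) p
  refine ⟨k, fun G _ _ _ d φ ε hd hε => ?_⟩
  let K := Subgroup.closure (Set.range φ)
  let φK : P → K := fun g => ⟨φ g, Subgroup.subset_closure ⟨g, rfl⟩⟩
  have hφK : Subgroup.closure (Set.range φK) = ⊤ := by
    have : Set.range φK = ((↑) : K → G) ⁻¹' Set.range φ := by
      ext x
      simp [φK, Subtype.ext_iff]
    rw [this]
    exact Subgroup.closure_closure_coe_preimage
  have hdK : IsBiInvMetric fun a b : K => d a b :=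
    ⟨fun g h => (hd.1 g h).trans Subtype.ext_iff.symm, fun g h => hd.2.1 g h,
      fun g h k => hd.2.2.1 g h k, fun g h k => hd.2.2.2.1 g h k, fun g h k => hd.2.2.2.2 g h k⟩
  let f : FreeGroup P →* K := FreeGroup.lift φK
  have hfφ : f ∘ FreeGroup.of = φK := by
    funext g; simp [f]
  have hf : (⊤ : Subgroup (FreeGroup P)).map f = ⊤ := by
    rw [← FreeGroup.closure_range_of, MonoidHom.map_closure, ← Set.range_comp, hfφ, hφK]
  have hrel : ∀ q, f (relator FreeGroup.of q) = relator φK q := fun q => by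
    rw [map_relator, hfφ]
  have hcomm : (commutator (FreeGroup P)).map f = commutator K := by
    rw [commutator_def, commutator_def, Subgroup.map_commutator, hf]
  obtain ⟨x, hx, -⟩ := exists_conjProd_eq_of_isSolvable hP e _ K φK (f ∘ s) (φK p) rfl hφK
    (fun z => by rw [Function.comp_apply, hse, hrel])
    (by rw [Set.range_comp, ← MonoidHom.map_closure, ← hcomm, ← Subgroup.map_sup, hs, hf])
    (by
      rw [← hcomm]
      refine ⟨_, hsp, ?_⟩
      rw [map_mul, map_inv, map_conjProd, ← hfφ]
      rfl)
  have hbound := hdK.dist_one_conjProd_le (f ∘ s) x (ε := ε) fun j => by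
    obtain ⟨q, h | h⟩ := hsr j
    · rw [Function.comp_apply, h, hrel, hdK.dist_one_relator]
      exact hε _ _
    · rw [Function.comp_apply, ← hdK.dist_one_inv, ← map_inv, h, hrel, hdK.dist_one_relator]
      exact hε _ _
  rw [hx] at hbound
  exact hbound

/-- A finite group is Sol-approximated if and only if it is solvable. -/
theorem finite_sol_approximated_iff_isSolvable
    (G : Type) [Group G] [Finite G] : IsSolApproximated G ↔ IsSolvable G := by
  classical
  constructor
  · rintro ⟨δ, -, hδ, happrox⟩
    by_contra hG
    obtain ⟨H, hH, hHH⟩ : ∃ H : Subgroup G, H ≠ ⊥ ∧ ¬ ⁅H, H⁆ < H := by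
      by_contra! h
      exact hG (Group.isSolvable_iff_commutator_lt.2 h)
    have hperf : commutator H = ⊤ := by
      refine Subgroup.map_injective H.subtype_injective ?_
      rw [← MonoidHom.range_eq_map, H.range_subtype, Subgroup.map_subtype_commutator]
      exact (Subgroup.commutator_le_self H).eq_of_not_lt hHH
    obtain ⟨p, hpH, hp⟩ := H.ne_bot_iff_exists_ne_one.1 hH |>.elim fun p hp =>
      (⟨p, p.2, by simpa using hp⟩ : ∃ p ∈ H, p ≠ 1)
    obtain ⟨k, hk⟩ := exists_forall_dist_one_le hperf ⟨p, hpH⟩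
    have := Fintype.ofFinite G
    have hδp := hδ p hp
    obtain ⟨K, _, _, hK, d, φ, hd, hmul, hδφ⟩ :=
      happrox Finset.univ (δ p / (k + 1)) (by positivity)
    have : Group.IsSolvable K := hK
    have h1 := hk K d (fun g => φ g) (δ p / (k + 1)) hd fun g h =>
      (hmul g h (Finset.mem_univ _) (Finset.mem_univ _) (Finset.mem_univ _)).le
    have h2 := hδφ p (Finset.mem_univ _)
    have h3 : k * (δ p / (k + 1)) < δ p := by
      rw [mul_div_assoc', div_lt_iff₀ (by positivity)]
      nlinarith
    exact absurd (h2.trans h1) (not_le.2 h3)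
  · intro hG
    refine ⟨fun g => if 1 = g then 0 else 1, fun g => by dsimp only; split_ifs <;> norm_num,
      fun g hg => by simp [hg.symm], fun S ε hε => ⟨G, _, ‹_›, hG, _, id, isBiInvMetric_discrete,
        fun g h _ _ _ => by simpa using hε, fun g _ => le_rfl⟩⟩
end

section
/- The compact simple Lie group SO(3,ℝ) of 3×3 real orthogonal matrices with determinant 1 is not an abstract quotient of a product of finite groups: for every family (G_i)_{i∈I} of finite groups, there is no surjective group homomorphism from the direct product ∏_{i∈I} G_i onto SO(3,ℝ). -/
/-- The special orthogonal group `SO(3,ℝ)`, realized as the subgroup of the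
(real) orthogonal group `O(3) = unitaryGroup (Fin 3) ℝ` consisting of the
matrices of determinant `1`. -/
def SO3 : Subgroup (Matrix.unitaryGroup (Fin 3) ℝ) where
  carrier := {A | (A : Matrix (Fin 3) (Fin 3) ℝ).det = 1}
  one_mem' := by simp
  mul_mem' := by
    intro a b ha hb
    simp only [Set.mem_setOf_eq, Matrix.UnitaryGroup.mul_val, Matrix.det_mul] at *
    rw [ha, hb, mul_one]
  inv_mem' := by
    intro a ha
    simp only [Set.mem_setOf_eq, Matrix.UnitaryGroup.inv_val] at *
    rw [Matrix.star_eq_conjTranspose, Matrix.det_conjTranspose, ha, star_one]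

open Polynomial in
/-- A trace on `A`, applied to coefficients, is a trace on `A[X]`. -/
theorem trace_coeff_mul_comm {A B : Type*} [Ring A] [AddCommGroup B] (τ : A →+ B)
    (hτ : ∀ u v, τ (u * v) = τ (v * u)) (P Q : A[X]) (k : ℕ) :
    τ ((P * Q).coeff k) = τ ((Q * P).coeff k) := by
  rw [coeff_mul, coeff_mul, map_sum, map_sum, ← Finset.Nat.sum_antidiagonal_swap]
  exact Finset.sum_congr rfl fun _ _ => hτ _ _

open Polynomial in
theorem trace_coeff_derivative_pow {A B : Type*} [Ring A] [AddCommGroup B] (τ : A →+ B)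
    (hτ : ∀ u v, τ (u * v) = τ (v * u)) (P : A[X]) (k n m : ℕ) :
    τ ((derivative (P ^ n) * P ^ m).coeff k) =
      n • τ ((derivative P * P ^ (n + m - 1)).coeff k) := by
  induction n generalizing m with
  | zero => simp
  | succ n ih =>
    have h : derivative (P ^ (n + 1)) * P ^ m =
        derivative (P ^ n) * P ^ (m + 1) + P ^ n * (derivative P * P ^ m) := by
      rw [pow_succ, derivative_mul, pow_succ' P m]
      noncomm_ring
    rw [h, coeff_add, map_add, ih, trace_coeff_mul_comm τ hτ (P ^ n), mul_assoc, ← pow_add,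
      succ_nsmul, show n + (m + 1) - 1 = n + 1 + m - 1 by omega,
      show m + n = n + 1 + m - 1 by omega]

open Polynomial in
/-- Modulo commutators, the `p`-th power map is additive in characteristic `p`. -/
theorem trace_add_pow {A B : Type*} [Ring A] [AddCommGroup B] (τ : A →+ B)
    (hτ : ∀ u v, τ (u * v) = τ (v * u)) {p : ℕ} (hp : p.Prime) (hB : ∀ b : B, p • b = 0)
    (a b : A) : τ ((a + b) ^ p) = τ (a ^ p) + τ (b ^ p) := by
  set P : A[X] := C a + C b * X with hP
  have hdeg : P.natDegree ≤ 1 := by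
    rw [hP]; compute_degree
  have hmid : ∀ k, 0 < k → k < p → τ ((P ^ p).coeff k) = 0 := by
    intro k hk hkp
    obtain ⟨k, rfl⟩ : ∃ j, k = j + 1 := ⟨k - 1, by omega⟩
    have h := trace_coeff_derivative_pow τ hτ P k p 0
    rw [hB, pow_zero, mul_one, coeff_derivative, ← Nat.cast_succ, ← nsmul_eq_mul', map_nsmul] at h
    have hc : Nat.Coprime (k + 1) p :=
      (Nat.coprime_of_lt_prime (by omega) hkp hp).symm
    have h1 := addOrderOf_dvd_of_nsmul_eq_zero h
    have h2 := addOrderOf_dvd_of_nsmul_eq_zero (hB (τ ((P ^ p).coeff (k + 1))))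
    exact AddMonoid.addOrderOf_eq_one_iff.1 (Nat.eq_one_of_dvd_coprimes hc h1 h2)
  let ev := eval₂RingHom' (RingHom.id A) 1 fun _ => Commute.one_right _
  have hev : ev (P ^ p) = (a + b) ^ p := by
    rw [map_pow]; simp [ev, hP]
  have hsum : (a + b) ^ p = ∑ k ∈ Finset.range (p + 1), (P ^ p).coeff k := by
    rw [← hev]
    have : (P ^ p).natDegree < p + 1 := by
      have := natDegree_pow_le_of_le p hdeg
      omega
    simp [ev, eval₂_eq_sum_range' _ this]
  have h0 : (P ^ p).coeff 0 = a ^ p := by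
    rw [← constantCoeff_apply, map_pow]; simp [hP]
  have hpp : (P ^ p).coeff p = b ^ p := by
    have := coeff_pow_of_natDegree_le (m := p) hdeg
    rw [mul_one] at this
    rw [this]; simp [hP]
  rw [hsum, map_sum, Finset.sum_range_succ, hpp]
  congr 1
  rw [Finset.sum_eq_single 0, h0]
  · intro k hk hk0
    exact hmid k (Nat.pos_of_ne_zero hk0) (Finset.mem_range.1 hk)
  · intro h
    exact absurd (Finset.mem_range.2 hp.pos) h

theorem trace_sum_pow {A B ι : Type*} [Ring A] [AddCommGroup B] (τ : A →+ B)
    (hτ : ∀ u v, τ (u * v) = τ (v * u)) {p : ℕ} (hp : p.Prime) (hB : ∀ b : B, p • b = 0)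
    (s : Finset ι) (a : ι → A) : τ ((∑ i ∈ s, a i) ^ p) = ∑ i ∈ s, τ (a i ^ p) := by
  classical
  induction s using Finset.induction_on with
  | empty => simp [hp.ne_zero]
  | insert i s hi ih =>
    rw [Finset.sum_insert hi, Finset.sum_insert hi, trace_add_pow τ hτ hp hB, ih]

open MonoidAlgebra in
/-- The sum of all conjugates of an element of a group algebra by group elements. -/
noncomputable def conjSum (k : Type*) {G : Type*} [CommRing k] [Group G] [Fintype G] :
    MonoidAlgebra k G →+ MonoidAlgebra k G :=
  ∑ g : G, (AddMonoidHom.mulLeft (of k G g)).comp (AddMonoidHom.mulRight (of k G g⁻¹))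

section ConjSum

variable {k G : Type*} [CommRing k] [Group G] [Fintype G]

open MonoidAlgebra

theorem conjSum_apply (f : MonoidAlgebra k G) :
    conjSum k f = ∑ g : G, of k G g * f * of k G g⁻¹ := by
  simp [conjSum, AddMonoidHom.finsetSum_apply, mul_assoc]

theorem conjSum_of (x : G) : conjSum k (of k G x) = ∑ g : G, of k G (g * x * g⁻¹) := by
  simp_rw [conjSum_apply, map_mul]

theorem of_mul_conjSum (h : G) (f : MonoidAlgebra k G) :
    of k G h * conjSum k f = conjSum k f * of k G h := by
  rw [conjSum_apply, Finset.mul_sum, Finset.sum_mul]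
  refine Fintype.sum_equiv (Equiv.mulLeft h) _ _ fun g => ?_
  simp only [Equiv.coe_mulLeft, mul_assoc, ← map_mul, mul_inv_rev, inv_mul_cancel, mul_one]
  simp only [map_mul, mul_assoc]

theorem commute_conjSum (f u : MonoidAlgebra k G) : Commute (conjSum k f) u := by
  induction u using MonoidAlgebra.induction_on with
  | of h => exact (of_mul_conjSum h f).symm
  | add u v hu hv => exact hu.add_right hv
  | smul r u hu => exact hu.smul_right r

theorem conjSum_smul (r : k) (f : MonoidAlgebra k G) : conjSum k (r • f) = r • conjSum k f := by
  simp [conjSum_apply, Finset.smul_sum]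

theorem conjSum_mul_comm (u v : MonoidAlgebra k G) :
    conjSum k (u * v) = conjSum k (v * u) := by
  induction u using MonoidAlgebra.induction_on with
  | of h =>
    rw [conjSum_apply, conjSum_apply]
    refine Fintype.sum_equiv (Equiv.mulRight h) _ _ fun g => ?_
    simp only [Equiv.coe_mulRight, mul_assoc, ← map_mul, mul_inv_rev, mul_inv_cancel_left]
    simp only [map_mul, mul_assoc]
  | add u w hu hw => rw [add_mul, mul_add, map_add, map_add, hu, hw]
  | smul r u hu => rw [smul_mul_assoc, mul_smul_comm, conjSum_smul, conjSum_smul, hu]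

theorem conjSum_of_commute (f : MonoidAlgebra k G) (hf : ∀ u, Commute f u) :
    conjSum k f = Fintype.card G • f := by
  have h (g : G) : of k G g * f * of k G g⁻¹ = f := by
    rw [← (hf _).eq, mul_assoc, ← map_mul, mul_inv_cancel, map_one, mul_one]
  rw [conjSum_apply, Finset.sum_congr rfl fun g _ => h g]
  simp

/-- The `p`-th power of the sum of the conjugates of `x` is the sum of the conjugates of `x ^ p`,
in characteristic `p` prime to the order of the group. -/
theorem conjSum_of_pow {p : ℕ} (hp : p.Prime) [CharP k p] (hG : p.Coprime (Fintype.card G))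
    (x : G) : conjSum k (of k G x) ^ p = conjSum k (of k G (x ^ p)) := by
  have hchar (b : MonoidAlgebra k G) : p • b = 0 := by
    rw [← Nat.cast_smul_eq_nsmul k, CharP.cast_eq_zero, zero_smul]
  have h : Fintype.card G • (conjSum k (of k G x) ^ p - conjSum k (of k G (x ^ p))) = 0 := by
    rw [smul_sub, ← conjSum_of_commute _ fun u => (commute_conjSum _ u).pow_left p, conjSum_of,
      trace_sum_pow _ conjSum_mul_comm hp hchar, sub_eq_zero,
      ← conjSum_of_commute _ (commute_conjSum _), conjSum_of (x ^ p), map_sum]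
    simp_rw [← map_pow, conj_pow]
  exact sub_eq_zero.1 (AddMonoid.addOrderOf_eq_one_iff.1 (Nat.eq_one_of_dvd_coprimes hG
    (addOrderOf_dvd_of_nsmul_eq_zero (hchar _)) (addOrderOf_dvd_of_nsmul_eq_zero h)))

end ConjSum

open MonoidAlgebra in
theorem exists_prime_pow_mul_eq {G : Type*} [Group G] [Fintype G] {p : ℕ} (hp : p.Prime)
    (hG : Fintype.card (G × G × G) < p) (x y : G) :
    ∃ a b : G, (x * y) ^ p = a * x ^ p * a⁻¹ * (b * y ^ p * b⁻¹) := by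
  classical
  have : Fact p.Prime := ⟨hp⟩
  have hcop : p.Coprime (Fintype.card G) := by
    refine Nat.coprime_of_lt_prime Fintype.card_ne_zero ?_ hp
    rw [Fintype.card_prod, Fintype.card_prod] at hG
    have := Fintype.card_pos (α := G)
    nlinarith [Nat.mul_le_mul this this,
      Nat.mul_le_mul_left (Fintype.card G) (Nat.mul_le_mul this this)]
  have hchar (b : MonoidAlgebra (ZMod p) G) : p • b = 0 := by
    rw [← Nat.cast_smul_eq_nsmul (ZMod p), CharP.cast_eq_zero, zero_smul]
  have hmul (u v : G) : conjSum (ZMod p) (of (ZMod p) G u) * conjSum (ZMod p) (of (ZMod p) G v) =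
      ∑ q : G × G, of (ZMod p) G (q.1 * u * q.1⁻¹ * (q.2 * v * q.2⁻¹)) := by
    simp_rw [conjSum_of, Finset.sum_mul_sum, ← map_mul, Fintype.sum_prod_type]
  have key := congrArg (conjSum (ZMod p)) ((commute_conjSum (k := ZMod p) (of (ZMod p) G x)
    (conjSum (ZMod p) (of (ZMod p) G y))).mul_pow p)
  rw [conjSum_of_pow hp hcop, conjSum_of_pow hp hcop, hmul, hmul,
    trace_sum_pow _ conjSum_mul_comm hp hchar, map_sum] at key
  simp_rw [← map_pow, conjSum_of] at key
  replace key := congrArg (fun f => f.coeff ((x * y) ^ p)) key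
  simp only [coeff_sum, of_apply, coeff_single, Finsupp.finsetSum_apply, Finsupp.single_apply,
    ← Fintype.sum_prod_type', Finset.sum_boole] at key
  by_contra! hne
  have hempty (q : (G × G) × G) :
      ¬ q.2 * (q.1.1 * x ^ p * q.1.1⁻¹ * (q.1.2 * y ^ p * q.1.2⁻¹)) * q.2⁻¹ = (x * y) ^ p := by
    intro hq
    refine hne (q.2 * q.1.1) (q.2 * q.1.2) ?_
    rw [← hq]
    group
  simp only [hempty, Finset.filter_false, Finset.card_empty, Nat.cast_zero,
    ZMod.natCast_eq_zero_iff] at key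
  refine absurd (Nat.le_of_dvd (Finset.card_pos.2 ⟨((1, 1), 1), by simp⟩) key) (not_le.2 ?_)
  refine (Finset.card_le_univ _).trans_lt ?_
  simpa [mul_assoc] using hG

/-- If `m` is prime to the order of a finite group, then the `m`-th power of `x * y` is a product of
a conjugate of `x ^ m` and a conjugate of `y ^ m`. -/
theorem exists_pow_mul_eq {G : Type*} [Group G] [Finite G] {m : ℕ} (hm : m.Coprime (Nat.card G))
    (x y : G) : ∃ a b : G, (x * y) ^ m = a * x ^ m * a⁻¹ * (b * y ^ m * b⁻¹) := by
  have := Fintype.ofFinite G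
  obtain ⟨p, hlt, hp, hpm⟩ := Nat.forall_exists_prime_gt_and_modEq
    (Fintype.card (G × G × G)) Nat.card_pos.ne' hm
  have hpow (g : G) : g ^ m = g ^ p :=
    pow_eq_pow_iff_modEq.2 (hpm.symm.of_dvd (orderOf_dvd_natCard g))
  simp_rw [hpow]
  exact exists_prime_pow_mul_eq hp hlt x y

/-- Complementary endomaps of a group `Γ` that behave like the projections to the odd part and to
the `2`-part of an element of a finite group. -/
structure TwoPartDecomposition (Γ : Type*) [Group Γ] where
  odd : Γ → Γ
  two : Γ → Γ
  odd_mul_two (x : Γ) : odd x * two x = x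
  commute (x : Γ) : Commute (odd x) (two x)
  odd_two (x : Γ) : odd (two x) = 1
  two_odd (x : Γ) : two (odd x) = 1
  odd_zpow (x : Γ) (m : ℤ) : odd (x ^ m) = odd x ^ m
  two_zpow (x : Γ) (m : ℤ) : two (x ^ m) = two x ^ m
  odd_conj (g x : Γ) : odd (g * x * g⁻¹) = g * odd x * g⁻¹
  two_conj (g x : Γ) : two (g * x * g⁻¹) = g * two x * g⁻¹
  exists_mul (x y : Γ) (j k : ℕ) (hj : Odd j) : ∃ a b : Γ,
    two (x * y) ^ j * odd (x * y) ^ 2 ^ k =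
      a * (two x ^ j * odd x ^ 2 ^ k) * a⁻¹ * (b * (two y ^ j * odd y ^ 2 ^ k) * b⁻¹)

theorem exists_odd_two_exponents {n : ℕ} (hn : n ≠ 0) : ∃ e f : ℕ, e + f ≡ 1 [MOD n] ∧
    e * f ≡ 0 [MOD n] ∧ ∀ j k : ℕ, Odd j → (f * j + e * 2 ^ k).Coprime n := by
  obtain ⟨a, b, hb, rfl⟩ := Nat.exists_eq_two_pow_mul_odd hn
  have hab : (2 ^ a).Coprime b := (Nat.coprime_two_left.2 hb).pow_left a
  obtain ⟨e, he2, heb⟩ := Nat.chineseRemainder hab 0 1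
  obtain ⟨f, hf2, hfb⟩ := Nat.chineseRemainder hab 1 0
  refine ⟨e, f, ?_, ?_, fun j k hj => ?_⟩
  · exact (Nat.modEq_and_modEq_iff_modEq_mul hab).1 ⟨he2.add hf2, heb.add hfb⟩
  · exact (Nat.modEq_and_modEq_iff_modEq_mul hab).1
      ⟨by simpa using he2.mul hf2, by simpa using heb.mul hfb⟩
  · have h2 : f * j + e * 2 ^ k ≡ j [MOD 2 ^ a] := by
      simpa using (hf2.mul_right j).add (he2.mul_right (2 ^ k))
    have hb' : f * j + e * 2 ^ k ≡ 2 ^ k [MOD b] := by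
      simpa using (hfb.mul_right j).add (heb.mul_right (2 ^ k))
    refine Nat.Coprime.mul_right ?_ ?_
    · rw [Nat.Coprime, h2.gcd_eq]
      exact (Nat.coprime_two_right.2 hj).pow_right a
    · rw [Nat.Coprime, hb'.gcd_eq]
      exact (Nat.coprime_two_left.2 hb).pow_left k

theorem exists_twoPartDecomposition_pi {I : Type*} (G : I → Type*) [∀ i, Group (G i)]
    [∀ i, Finite (G i)] : Nonempty (TwoPartDecomposition (∀ i, G i)) := by
  choose e f hadd hmul hcop using fun i => exists_odd_two_exponents (Nat.card_pos (α := G i)).ne'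
  have hpow {i : I} (g : G i) {m n : ℕ} (h : m ≡ n [MOD Nat.card (G i)]) : g ^ m = g ^ n :=
    pow_eq_pow_iff_modEq.2 (h.of_dvd (orderOf_dvd_natCard g))
  refine ⟨{
    odd := fun x i => x i ^ e i
    two := fun x i => x i ^ f i
    odd_mul_two := fun x => funext fun i => ?_
    commute := fun x => funext fun i => ((Commute.refl (x i)).pow_pow _ _).eq
    odd_two := fun x => funext fun i => ?_
    two_odd := fun x => funext fun i => ?_
    odd_zpow := fun x m => funext fun i => ?_
    two_zpow := fun x m => funext fun i => ?_
    odd_conj := fun g x => funext fun i => conj_pow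
    two_conj := fun g x => funext fun i => conj_pow
    exists_mul := fun x y j k hj => ?_ }⟩
  · simp [← pow_add, hpow _ (hadd i)]
  · simp [← pow_mul, mul_comm (f i), hpow _ (hmul i)]
  · simp [← pow_mul, hpow _ (hmul i)]
  · simp only [Pi.pow_apply, ← zpow_natCast, ← zpow_mul, mul_comm]
  · simp only [Pi.pow_apply, ← zpow_natCast, ← zpow_mul, mul_comm]
  · choose a b hab using fun i => exists_pow_mul_eq (hcop i j k hj) (x i) (y i)
    refine ⟨a, b, funext fun i => ?_⟩
    simpa [pow_add, pow_mul] using hab i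

section Length

variable {Γ : Type*} [Group Γ] (D : TwoPartDecomposition Γ) (l : GroupSeminorm Γ)

namespace TwoPartDecomposition

theorem two_eq_self {x : Γ} (hx : D.odd x = 1) : D.two x = x := by
  simpa [hx] using D.odd_mul_two x

theorem odd_eq_self {x : Γ} (hx : D.two x = 1) : D.odd x = x := by
  simpa [hx] using D.odd_mul_two x

theorem seminorm_exists_mul (hl : ∀ g x, l (g * x * g⁻¹) = l x)
    (x y : Γ) (j k : ℕ) (hj : Odd j) :
    l (D.two (x * y) ^ j * D.odd (x * y) ^ 2 ^ k) ≤
      l (D.two x ^ j * D.odd x ^ 2 ^ k) + l (D.two y ^ j * D.odd y ^ 2 ^ k) := by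
  obtain ⟨a, b, h⟩ := D.exists_mul x y j k hj
  rw [h]
  exact (map_mul_le_add l _ _).trans_eq (by rw [hl, hl])

theorem seminorm_mul_sq_le (hl : ∀ g x, l (g * x * g⁻¹) = l x) {x y : Γ}
    (hx : D.two x = 1) (hy : D.two y = 1) :
    l ((x * y) ^ 2) ≤ 5 * (l (x ^ 2) + l (y ^ 2)) := by
  have key (j k : ℕ) (hj : Odd j) := D.seminorm_exists_mul l hl x y j k hj
  simp only [hx, hy, D.odd_eq_self hx, D.odd_eq_self hy, one_pow, one_mul] at key
  have h11 := key 1 1 (by decide)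
  have h12 := key 1 2 (by decide)
  have h31 := key 3 1 (by decide)
  have hc := D.commute (x * y)
  have hxy := D.odd_mul_two (x * y)
  set u := D.odd (x * y)
  set v := D.two (x * y)
  have hx4 : l (x ^ 2 ^ 2) ≤ l (x ^ 2) + l (x ^ 2) := by
    rw [show x ^ 2 ^ 2 = x ^ 2 * x ^ 2 by group]
    exact map_mul_le_add l _ _
  have hy4 : l (y ^ 2 ^ 2) ≤ l (y ^ 2) + l (y ^ 2) := by
    rw [show y ^ 2 ^ 2 = y ^ 2 * y ^ 2 by group]
    exact map_mul_le_add l _ _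
  have hu : l (u ^ 2) ≤ l (v ^ 1 * u ^ 2 ^ 1) + l (v ^ 1 * u ^ 2 ^ 2) := by
    have h : u ^ 2 = (v ^ 1 * u ^ 2 ^ 1)⁻¹ * (v ^ 1 * u ^ 2 ^ 2) := by group
    rw [h, ← map_inv_eq_map l (v ^ 1 * u ^ 2 ^ 1)]
    exact map_mul_le_add l _ _
  have hv : l (v ^ 2) ≤ l (v ^ 3 * u ^ 2 ^ 1) + l (v ^ 1 * u ^ 2 ^ 1) := by
    have h : v ^ 2 = (v ^ 3 * u ^ 2 ^ 1) * (v ^ 1 * u ^ 2 ^ 1)⁻¹ := by group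
    rw [h, ← map_inv_eq_map l (v ^ 1 * u ^ 2 ^ 1)]
    exact map_mul_le_add l _ _
  have := map_mul_le_add l (u ^ 2) (v ^ 2)
  rw [← hxy, hc.mul_pow]
  norm_num at *
  linarith

theorem seminorm_mul_cube_le (hl : ∀ g x, l (g * x * g⁻¹) = l x) {x y : Γ}
    (hx : D.odd x = 1) (hy : D.odd y = 1) :
    l ((x * y) ^ 3) ≤ 9 * (l (x ^ 3) + l (y ^ 3)) := by
  have key (j k : ℕ) (hj : Odd j) := D.seminorm_exists_mul l hl x y j k hj
  simp only [hx, hy, D.two_eq_self hx, D.two_eq_self hy, one_pow, mul_one] at key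
  have h30 := key 3 0 (by decide)
  have h31 := key 3 1 (by decide)
  have hc := D.commute (x * y)
  have hxy := D.odd_mul_two (x * y)
  set u := D.odd (x * y)
  set v := D.two (x * y)
  have hu : l u ≤ l (v ^ 3 * u ^ 2 ^ 0) + l (v ^ 3 * u ^ 2 ^ 1) := by
    have h : u = (v ^ 3 * u ^ 2 ^ 0)⁻¹ * (v ^ 3 * u ^ 2 ^ 1) := by group
    rw [← map_inv_eq_map l (v ^ 3 * u ^ 2 ^ 0)]
    exact (congrArg l h).trans_le (map_mul_le_add l _ _)
  have hv : l (v ^ 3) ≤ l (v ^ 3 * u ^ 2 ^ 0) + l u := by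
    have h : v ^ 3 = (v ^ 3 * u ^ 2 ^ 0) * u⁻¹ := by group
    rw [← map_inv_eq_map l u]
    exact (congrArg l h).trans_le (map_mul_le_add l _ _)
  have h1 := map_mul_le_add l (u ^ 3) (v ^ 3)
  have h2 := map_mul_le_add l (u ^ 2) u
  have h3 := map_mul_le_add l u u
  rw [← pow_succ] at h2
  rw [← sq] at h3
  rw [← hxy, hc.mul_pow]
  norm_num at *
  linarith

end TwoPartDecomposition

end Length

section SO3

open Matrix
open scoped Matrix.Norms.L2Operator

/-- The underlying matrix of an element of `SO3`. -/
noncomputable def so3ToMatrix : SO3 →* Matrix (Fin 3) (Fin 3) ℝ :=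
  (Submonoid.subtype _).comp SO3.subtype

theorem norm_so3ToMatrix_mul (A : SO3) (M : Matrix (Fin 3) (Fin 3) ℝ) :
    ‖so3ToMatrix A * M‖ = ‖M‖ :=
  CStarRing.norm_coe_unitary_mul A.1 M

theorem norm_mul_so3ToMatrix (A : SO3) (M : Matrix (Fin 3) (Fin 3) ℝ) :
    ‖M * so3ToMatrix A‖ = ‖M‖ :=
  CStarRing.norm_mul_coe_unitary M A.1

theorem so3ToMatrix_injective : Function.Injective so3ToMatrix :=
  Subtype.val_injective.comp Subtype.val_injective

/-- The distance to the identity in the operator norm, as a seminorm on the group `SO3`. -/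
noncomputable def so3Seminorm : GroupSeminorm SO3 where
  toFun A := ‖so3ToMatrix A - 1‖
  map_one' := by rw [map_one, sub_self, norm_zero]
  mul_le' A B := by
    have h : so3ToMatrix (A * B) - 1 =
        (so3ToMatrix A - 1) + so3ToMatrix A * (so3ToMatrix B - 1) := by
      rw [map_mul, mul_sub, mul_one]
      abel
    rw [h]
    exact (norm_add_le _ _).trans_eq (by rw [norm_so3ToMatrix_mul])
  inv' A := by
    rw [← norm_so3ToMatrix_mul A, mul_sub, ← map_mul, mul_inv_cancel, map_one, mul_one,
      norm_sub_rev]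

theorem so3Seminorm_apply (A : SO3) : so3Seminorm A = ‖so3ToMatrix A - 1‖ := rfl

theorem so3Seminorm_conj (A B : SO3) : so3Seminorm (A * B * A⁻¹) = so3Seminorm B := by
  have h : so3ToMatrix (A * B * A⁻¹) - 1 =
      so3ToMatrix A * (so3ToMatrix B - 1) * so3ToMatrix A⁻¹ := by
    rw [mul_sub, sub_mul, mul_one, ← map_mul, ← map_mul, ← map_mul, mul_inv_cancel, map_one]
  rw [so3Seminorm_apply, h, norm_mul_so3ToMatrix, norm_so3ToMatrix_mul, so3Seminorm_apply]

theorem so3Seminorm_eq_zero {A : SO3} (h : so3Seminorm A = 0) : A = 1 :=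
  so3ToMatrix_injective ((sub_eq_zero.1 (norm_eq_zero.1 h)).trans (map_one _).symm)

theorem continuous_so3Seminorm : Continuous so3Seminorm :=
  ((continuous_subtype_val.comp continuous_subtype_val).sub continuous_const).norm

theorem exists_so3ToMatrix_eq {M : Matrix (Fin 3) (Fin 3) ℝ} (h : M * Mᵀ = 1) (hdet : M.det = 1) :
    ∃ A : SO3, so3ToMatrix A = M :=
  ⟨⟨⟨M, by
    rwa [mem_unitaryGroup_iff, star_eq_conjTranspose, conjTranspose_eq_transpose_of_trivial]⟩,
    hdet⟩, rfl⟩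

theorem so3ToMatrix_mul_transpose (A : SO3) : so3ToMatrix A * (so3ToMatrix A)ᵀ = 1 := by
  have := (mem_unitaryGroup_iff (A := A.1.1)).1 A.1.2
  rwa [star_eq_conjTranspose, conjTranspose_eq_transpose_of_trivial] at this

theorem det_so3ToMatrix (A : SO3) : (so3ToMatrix A).det = 1 := A.2

/-- The matrix of the rotation by the angle `α` about the third coordinate axis. -/
noncomputable def rotMatrix (α : Real.Angle) : Matrix (Fin 3) (Fin 3) ℝ :=
  !![α.cos, -α.sin, 0; α.sin, α.cos, 0; 0, 0, 1]

/-- The rotations about the third coordinate axis. -/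
noncomputable def rot : Multiplicative Real.Angle →* SO3 where
  toFun α := ⟨⟨rotMatrix α.toAdd, by
    have := Real.Angle.cos_sq_add_sin_sq α.toAdd
    rw [mem_unitaryGroup_iff, rotMatrix]
    ext i j
    fin_cases i <;> fin_cases j <;>
      simp [Matrix.mul_apply, Fin.sum_univ_three, star_eq_conjTranspose] <;> linarith⟩, by
    have := Real.Angle.cos_sq_add_sin_sq α.toAdd
    change Matrix.det (rotMatrix _) = 1
    simp [det_fin_three, rotMatrix]
    linarith⟩
  map_one' := by
    refine so3ToMatrix_injective ?_
    change rotMatrix 0 = 1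
    ext i j
    fin_cases i <;> fin_cases j <;> simp [rotMatrix]
  map_mul' α β := by
    refine so3ToMatrix_injective ?_
    change rotMatrix (α.toAdd + β.toAdd) = rotMatrix α.toAdd * rotMatrix β.toAdd
    ext i j
    fin_cases i <;> fin_cases j <;>
      simp [rotMatrix, Real.Angle.cos_add, Real.Angle.sin_add] <;> ring

theorem so3ToMatrix_rot (α : Real.Angle) : so3ToMatrix (rot (.ofAdd α)) = rotMatrix α := rfl

theorem continuous_rot : Continuous fun α : Real.Angle => rot (.ofAdd α) := by
  refine Continuous.subtype_mk (Continuous.subtype_mk ?_ _) _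
  have h1 := Real.Angle.continuous_cos
  have h2 := Real.Angle.continuous_sin
  refine continuous_matrix fun i j => ?_
  fin_cases i <;> fin_cases j <;> simp [rotMatrix] <;> fun_prop

theorem exists_rot_eq_of_commute {A : SO3} {θ : Real.Angle} (hθ : θ.sin ≠ 0)
    (h : Commute A (rot (.ofAdd θ))) : ∃ α : Real.Angle, A = rot (.ofAdd α) := by
  have hc := congrArg so3ToMatrix h.eq
  have hA := so3ToMatrix_mul_transpose A
  have hdet := det_so3ToMatrix A
  rw [map_mul, map_mul, so3ToMatrix_rot] at hc
  suffices ∃ α, so3ToMatrix A = rotMatrix α from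
    this.imp fun α hα => so3ToMatrix_injective hα
  generalize so3ToMatrix A = M at *
  have hs : 0 < θ.sin ^ 2 := by positivity
  have hc' (i j) := congrFun₂ hc i j
  have hA' (i j) := congrFun₂ hA i j
  simp only [rotMatrix, Fin.forall_fin_succ, Matrix.mul_apply, Fin.sum_univ_three] at hc' hA'
  simp at hc' hA'
  rw [det_fin_three] at hdet
  obtain ⟨⟨h00, h01, h02⟩, ⟨-, -, h12⟩, h20, h21⟩ := hc'
  have e02 : M 0 2 = 0 := by
    have : ((1 - θ.cos) ^ 2 + θ.sin ^ 2) * M 0 2 = 0 := by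
      linear_combination (1 - θ.cos) * h02 - θ.sin * h12
    exact (mul_eq_zero.1 this).resolve_left (by positivity)
  have e12 : M 1 2 = 0 := by
    have : ((1 - θ.cos) ^ 2 + θ.sin ^ 2) * M 1 2 = 0 := by
      linear_combination (1 - θ.cos) * h12 + θ.sin * h02
    exact (mul_eq_zero.1 this).resolve_left (by positivity)
  have e20 : M 2 0 = 0 := by
    have : ((1 - θ.cos) ^ 2 + θ.sin ^ 2) * M 2 0 = 0 := by
      linear_combination -(1 - θ.cos) * h20 - θ.sin * h21
    exact (mul_eq_zero.1 this).resolve_left (by positivity)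
  have e21 : M 2 1 = 0 := by
    have : ((1 - θ.cos) ^ 2 + θ.sin ^ 2) * M 2 1 = 0 := by
      linear_combination -(1 - θ.cos) * h21 + θ.sin * h20
    exact (mul_eq_zero.1 this).resolve_left (by positivity)
  have e01 : M 0 1 = -M 1 0 := mul_left_cancel₀ hθ (by linear_combination h00)
  have e11 : M 1 1 = M 0 0 := mul_left_cancel₀ hθ (by linear_combination h01)
  have hnorm : M 0 0 ^ 2 + M 1 0 ^ 2 = 1 := by
    have := hA'.1.1
    rw [e02, e01] at this
    linear_combination this
  have e22 : M 2 2 = 1 := by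
    rw [e02, e12, e01, e11] at hdet
    linear_combination hdet - M 2 2 * hnorm
  have hz : ‖(⟨M 0 0, M 1 0⟩ : ℂ)‖ = 1 := by
    rw [Complex.norm_eq_sqrt_sq_add_sq, hnorm, Real.sqrt_one]
  have hz0 : (⟨M 0 0, M 1 0⟩ : ℂ) ≠ 0 := by
    rw [← norm_ne_zero_iff, hz]
    exact one_ne_zero
  refine ⟨(Complex.arg ⟨M 0 0, M 1 0⟩ : ℝ), ?_⟩
  ext i j
  fin_cases i <;> fin_cases j <;>
    simp [rotMatrix, Complex.cos_arg hz0, Complex.sin_arg, hz, e02, e12, e20, e21, e01, e11, e22]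

theorem rot_injective : Function.Injective rot := by
  intro α β h
  have h' := congrArg so3ToMatrix h
  have hc : α.toAdd.cos = β.toAdd.cos := congrFun₂ h' 0 0
  have hs : α.toAdd.sin = β.toAdd.sin := congrFun₂ h' 1 0
  change α.toAdd = β.toAdd
  generalize α.toAdd = a, β.toAdd = b at *
  induction a using Real.Angle.induction_on
  induction b using Real.Angle.induction_on
  exact Real.Angle.cos_sin_inj hc hs

theorem Real.Angle.exists_addOrderOf_eq_zero : ∃ θ : Real.Angle, addOrderOf θ = 0 := by
  have : Fact (0 < 2 * Real.pi) := ⟨Real.two_pi_pos⟩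
  have h : addOrderOf ((√2 * (2 * Real.pi) : ℝ) : AddCircle (2 * Real.pi)) = 0 := by
    rw [← AddCircle.denseRange_zsmul_iff, AddCircle.denseRange_zsmul_coe_iff,
      mul_div_cancel_right₀ _ Real.two_pi_pos.ne']
    exact irrational_sqrt_two
  exact ⟨_, h⟩

theorem Real.Angle.denseRange_zsmul {θ : Real.Angle} (h : addOrderOf θ = 0) :
    DenseRange fun m : ℤ => m • θ :=
  have : Fact (0 < 2 * Real.pi) := ⟨Real.two_pi_pos⟩
  AddCircle.denseRange_zsmul_iff (p := 2 * Real.pi).2 h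

/-- An inequality for the powers of a rotation of infinite order extends to all rotations with the
same axis, by continuity. -/
theorem mul_conj_pow_eq_one {α β : Real.Angle} (hβ : addOrderOf β = 0) {q : ℕ} {C : ℝ} {g : SO3}
    (h : ∀ m : ℤ, so3Seminorm ((rot (.ofAdd β) ^ m * (g * rot (.ofAdd β) ^ m * g⁻¹)) ^ q) ≤
      C * (so3Seminorm ((rot (.ofAdd β) ^ m) ^ q) +
        so3Seminorm ((g * rot (.ofAdd β) ^ m * g⁻¹) ^ q)))
    (hα : rot (.ofAdd α) ^ q = 1) :
    (rot (.ofAdd α) * (g * rot (.ofAdd α) * g⁻¹)) ^ q = 1 := by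
  have hcl : IsClosed {γ : Real.Angle |
      so3Seminorm ((rot (.ofAdd γ) * (g * rot (.ofAdd γ) * g⁻¹)) ^ q) ≤
        C * (so3Seminorm (rot (.ofAdd γ) ^ q) + so3Seminorm ((g * rot (.ofAdd γ) * g⁻¹) ^ q))} := by
    have h1 := continuous_rot
    have h2 := continuous_so3Seminorm
    exact isClosed_le (by fun_prop) (by fun_prop)
  have hmem := isClosed_property (Real.Angle.denseRange_zsmul hβ) hcl (fun m => by
    simpa only [Set.mem_ofPred_eq, ofAdd_zsmul, map_zpow] using h m) α
  rw [conj_pow, hα, mul_one, mul_inv_cancel, map_one_eq_zero, add_zero, mul_zero] at hmem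
  exact so3Seminorm_eq_zero (hmem.antisymm (apply_nonneg _ _))

theorem so3ToMatrix_inv (A : SO3) : so3ToMatrix A⁻¹ = (so3ToMatrix A)ᵀ := by
  rw [← one_mul (so3ToMatrix A)ᵀ, ← map_one so3ToMatrix, ← inv_mul_cancel A, map_mul, mul_assoc,
    so3ToMatrix_mul_transpose, mul_one]

/-- There are half-turns in `SO3` whose product does not square to `1`. -/
theorem exists_half_turns : ∃ (α : Real.Angle) (g : SO3), rot (.ofAdd α) ^ 2 = 1 ∧
    (rot (.ofAdd α) * (g * rot (.ofAdd α) * g⁻¹)) ^ 2 ≠ 1 := by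
  obtain ⟨g, hg⟩ : ∃ g : SO3, so3ToMatrix g = !![4/5, 0, 3/5; 0, 1, 0; -3/5, 0, 4/5] := by
    refine exists_so3ToMatrix_eq ?_ ?_
    · ext i j
      fin_cases i <;> fin_cases j <;> simp [Matrix.mul_apply, Fin.sum_univ_three] <;> norm_num
    · simp [det_fin_three]; norm_num
  refine ⟨Real.pi, g, ?_, fun h => ?_⟩
  · rw [← map_pow, ← ofAdd_nsmul, Real.Angle.two_nsmul_coe_pi, ofAdd_zero, map_one]
  · have hN : so3ToMatrix (rot (.ofAdd Real.pi) * (g * rot (.ofAdd Real.pi) * g⁻¹)) =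
        !![7/25, 0, -24/25; 0, 1, 0; 24/25, 0, 7/25] := by
      rw [map_mul, map_mul, map_mul, so3ToMatrix_inv, so3ToMatrix_rot, hg, rotMatrix]
      ext i j
      fin_cases i <;> fin_cases j <;>
        simp [Matrix.mul_apply, vecMul, dotProduct, Fin.sum_univ_three] <;> norm_num
    have h' := congrFun₂ (congrArg so3ToMatrix h) 0 0
    rw [map_pow, hN, map_one, sq] at h'
    simp at h'
    norm_num at h'

/-- There are conjugate rotations of order `3` whose product does not cube to `1`. -/
theorem exists_third_turns : ∃ (α : Real.Angle) (g : SO3), rot (.ofAdd α) ^ 3 = 1 ∧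
    (rot (.ofAdd α) * (g * rot (.ofAdd α) * g⁻¹)) ^ 3 ≠ 1 := by
  obtain ⟨g, hg⟩ : ∃ g : SO3, so3ToMatrix g = !![0, 0, 1; 1, 0, 0; 0, 1, 0] := by
    refine exists_so3ToMatrix_eq ?_ ?_
    · ext i j
      fin_cases i <;> fin_cases j <;> simp [Matrix.mul_apply, Fin.sum_univ_three]
    · simp [det_fin_three]
  have hc : Real.cos (2 * Real.pi / 3) = -1 / 2 := by
    rw [show 2 * Real.pi / 3 = Real.pi - Real.pi / 3 by ring, Real.cos_pi_sub,
      Real.cos_pi_div_three]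
    norm_num
  obtain ⟨s, hs⟩ : ∃ s, Real.sin (2 * Real.pi / 3) = s := ⟨_, rfl⟩
  have hs2 : s ^ 2 = 3 / 4 := by
    rw [← hs, Real.sin_sq, hc]
    norm_num
  refine ⟨(2 * Real.pi / 3 : ℝ), g, ?_, fun h => ?_⟩
  · rw [← map_pow, ← ofAdd_nsmul, ← Real.Angle.coe_nsmul, nsmul_eq_mul, Nat.cast_ofNat,
      mul_div_cancel₀ _ three_ne_zero, Real.Angle.coe_two_pi, ofAdd_zero, map_one]
  · have hN : so3ToMatrix (rot (.ofAdd (2 * Real.pi / 3 : ℝ)) *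
        (g * rot (.ofAdd (2 * Real.pi / 3 : ℝ)) * g⁻¹)) =
        !![-1/2, s/2, s^2; s, 1/4, s/2; 0, s, -1/2] := by
      rw [map_mul, map_mul, map_mul, so3ToMatrix_inv, so3ToMatrix_rot, hg, rotMatrix,
        Real.Angle.cos_coe, Real.Angle.sin_coe, hc, hs]
      ext i j
      fin_cases i <;> fin_cases j <;>
        simp [Matrix.mul_apply, vecMul, dotProduct, Fin.sum_univ_three] <;> ring
    have h' := congrFun₂ (congrArg so3ToMatrix h) 2 0
    rw [map_pow, hN, map_one, pow_succ, sq] at h'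
    simp at h'
    nlinarith

end SO3

/-- `SO(3,ℝ)` is not an abstract quotient of a product of finite groups. -/
theorem so3_not_quotient_of_product_of_finite_groups
    {I : Type*} (Gf : I → Type*) [∀ i, Group (Gf i)] [∀ i, Finite (Gf i)]
    (f : ((i : I) → Gf i) →* SO3) : ¬ Function.Surjective f := by
  intro hf
  obtain ⟨D⟩ := exists_twoPartDecomposition_pi Gf
  obtain ⟨θ, hθ⟩ := Real.Angle.exists_addOrderOf_eq_zero
  have hsin : θ.sin ≠ 0 := by
    intro h
    have h2 : (2 : ℕ) • θ = 0 := by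
      rcases Real.Angle.sin_eq_zero_iff.1 h with rfl | rfl
      · exact smul_zero _
      · exact Real.Angle.two_nsmul_coe_pi
    exact (addOrderOf_eq_zero_iff'.1 hθ) 2 two_pos h2
  obtain ⟨x, hx⟩ := hf (rot (.ofAdd θ))
  have hodd : Commute (D.odd x) x := by
    conv_rhs => rw [← D.odd_mul_two x]
    exact (Commute.refl _).mul_right (D.commute x)
  have htwo : Commute (D.two x) x := by
    conv_rhs => rw [← D.odd_mul_two x]
    exact (D.commute x).symm.mul_right (Commute.refl _)
  obtain ⟨β, hβ⟩ := exists_rot_eq_of_commute hsin (hx ▸ hodd.map f)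
  obtain ⟨γ, hγ⟩ := exists_rot_eq_of_commute hsin (hx ▸ htwo.map f)
  have hsum : β + γ = θ := by
    refine Multiplicative.ofAdd.injective (rot_injective ?_)
    rw [ofAdd_add, map_mul, ← hβ, ← hγ, ← map_mul, D.odd_mul_two, hx]
  have hl (g y : ∀ i, Gf i) : so3Seminorm.comp f (g * y * g⁻¹) = so3Seminorm.comp f y := by
    rw [GroupSeminorm.comp_apply, map_mul f, map_mul f, map_inv f, so3Seminorm_conj,
      GroupSeminorm.comp_apply]
  by_cases h0 : addOrderOf β = 0
  · obtain ⟨α, g, hα, hne⟩ := exists_half_turns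
    obtain ⟨g, rfl⟩ := hf g
    refine hne (mul_conj_pow_eq_one h0 (C := 5) (fun m => ?_) hα)
    have htwo_pow : D.two (D.odd x ^ m) = 1 := by rw [D.two_zpow, D.two_odd, one_zpow]
    have := D.seminorm_mul_sq_le (so3Seminorm.comp f) hl htwo_pow (y := g * D.odd x ^ m * g⁻¹)
      (by rw [D.two_conj, htwo_pow, mul_one, mul_inv_cancel])
    simpa only [GroupSeminorm.comp_apply, map_mul, map_pow, map_zpow, map_inv, hβ] using this
  · have hγ0 : addOrderOf γ = 0 := by
      by_contra hγ0
      refine addOrderOf_eq_zero_iff.1 hθ ?_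
      rw [← hsum]
      exact IsOfFinAddOrder.add (addOrderOf_ne_zero_iff.1 h0) (addOrderOf_ne_zero_iff.1 hγ0)
    obtain ⟨α, g, hα, hne⟩ := exists_third_turns
    obtain ⟨g, rfl⟩ := hf g
    refine hne (mul_conj_pow_eq_one hγ0 (C := 9) (fun m => ?_) hα)
    have hodd_pow : D.odd (D.two x ^ m) = 1 := by rw [D.odd_zpow, D.odd_two, one_zpow]
    have := D.seminorm_mul_cube_le (so3Seminorm.comp f) hl hodd_pow (y := g * D.two x ^ m * g⁻¹)
      (by rw [D.odd_conj, hodd_pow, mul_one, mul_inv_cancel])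
    simpa only [GroupSeminorm.comp_apply, map_mul, map_pow, map_zpow, map_inv, hγ] using this
end

section
/- The group Γ = ⟨x,y | x^{-2}y^{-3}, x^{-2}(xy)^{5}⟩, i.e., the quotient of the free group on two generators x,y by the normal closure of the elements x^{-2}y^{-3} and x^{-2}(xy)^{5}, is not Nil-approximated. -/
/-- `Γ` is approximated by the class of finite nilpotent groups equipped with
bi-invariant metrics. -/
def IsNilApproximated (Γ : Type*) [Group Γ] : Prop :=
  ∃ δ : Γ → ℝ, (∀ g : Γ, 0 ≤ δ g) ∧ (∀ g : Γ, g ≠ 1 → 0 < δ g) ∧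
    ∀ (S : Finset Γ) (ε : ℝ), 0 < ε →
      ∃ (G : Type) (_ : Group G) (_ : Finite G) (_ : Group.IsNilpotent G)
        (d : G → G → ℝ) (φ : Γ → G),
        IsBiInvMetric d ∧
        (∀ g h : Γ, g ∈ S → h ∈ S → g * h ∈ S → d (φ g * φ h) (φ (g * h)) < ε) ∧
        (∀ g ∈ S, δ g ≤ d 1 (φ g))

open Subgroup commutatorElement in
/-- If `⁅A, G⁆` is central and `G` is generated by `r`, `s` modulo its commutator subgroup, then
every element of `⁅A, G⁆` is a product of a commutator with `r` and a commutator with `s`. -/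
lemma exists_commutator_mul_of_central {G : Type*} [Group G] (A : Subgroup G)
    (hA : ⁅A, (⊤ : Subgroup G)⁆ ≤ center G) {r s : G}
    (h : closure {r, s} ⊔ commutator G = ⊤) {z : G} (hz : z ∈ ⁅A, (⊤ : Subgroup G)⁆) :
    ∃ u v : G, z = ⁅r, u⁆ * ⁅s, v⁆ ∧ ⁅r, u⁆ ∈ center G ∧ ⁅s, v⁆ ∈ center G := by
  have hc : ∀ (g : G) (x : A), ⁅g, (x : G)⁆ ∈ center G := fun g x =>
    hA (commutator_comm (⊤ : Subgroup G) A ▸ commutator_mem_commutator (mem_top g) x.2)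
  let right (g : G) : A →* center G := MonoidHom.mk' (fun x => ⟨⁅g, (x : G)⁆, hc g x⟩) <| by
    intro x y
    ext
    have h1 := mem_center_iff.mp (hc g y) x
    simp only [coe_mul]
    calc ⁅g, (x * y : G)⁆ = ⁅g, (x : G)⁆ * (x * ⁅g, (y : G)⁆ * (x : G)⁻¹) := by
          simp only [commutatorElement_def]; group
      _ = _ := by rw [h1]; group
  let left (x : A) : G →* center G := MonoidHom.mk' (fun g => ⟨⁅g, (x : G)⁆, hc g x⟩) <| by
    intro g k
    ext
    have h1 := mem_center_iff.mp (hc k x) g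
    have h2 := mem_center_iff.mp (hc k x) ⁅g, (x : G)⁆
    simp only [coe_mul]
    calc ⁅g * k, (x : G)⁆ = (g * ⁅k, (x : G)⁆ * g⁻¹) * ⁅g, (x : G)⁆ := by
          simp only [commutatorElement_def]; group
      _ = _ := by rw [h1, h2]; group
  let F : A × A →* center G := (right r).noncommCoprod (right s) fun x y =>
    Subtype.ext (mem_center_iff.mp (hc s y) _)
  have key : ∀ x : A, (F.range.comap (left x)) = ⊤ := by
    intro x
    rw [eq_top_iff, ← h, sup_le_iff, closure_le]
    refine ⟨?_, commutator_le.mpr ?_⟩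
    · rintro g (rfl | rfl)
      · exact ⟨(x, 1), (congrArg (right g x * ·) (map_one (right s))).trans (mul_one _)⟩
      · exact ⟨(1, x), (congrArg (· * right g x) (map_one (right r))).trans (one_mul _)⟩
    · intro g _ k _
      rw [mem_comap, map_commutatorElement, commutatorElement_eq_one_iff_mul_comm.mpr
        (Subtype.ext (mem_center_iff.mp (left x k).2 _))]
      exact one_mem _
  have hle : ⁅A, (⊤ : Subgroup G)⁆ ≤ F.range.map (center G).subtype := by
    rw [commutator_comm, commutator_le]
    intro g _ x hx
    have : g ∈ F.range.comap (left ⟨x, hx⟩) := by rw [key]; trivial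
    exact ⟨_, this, rfl⟩
  obtain ⟨_, ⟨⟨u, v⟩, rfl⟩, rfl⟩ := hle hz
  exact ⟨u, v, rfl, hc r u, hc s v⟩

open Subgroup commutatorElement in
/-- In a nilpotent group generated by `r`, `s` modulo commutators, every element of the commutator
subgroup is a product of a commutator with `r` and a commutator with `s`. -/
lemma exists_commutator_mul_of_lowerCentralSeries_eq_bot (n : ℕ) :
    ∀ {G : Type*} [Group G], (⊤ : Subgroup G).lowerCentralSeries (n + 1) = ⊥ →
      ∀ {r s : G}, closure {r, s} ⊔ commutator G = ⊤ →
      ∀ {g : G}, g ∈ commutator G → ∃ u v : G, g = ⁅r, u⁆ * ⁅s, v⁆ := by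
  induction n with
  | zero =>
    intro G _ hG r s _ g hg
    rw [zero_add, top_lowerCentralSeries_one] at hG
    rw [hG, mem_bot] at hg
    exact ⟨1, 1, by simp [hg]⟩
  | succ n ih =>
    intro G _ hG r s h g hg
    set N := (⊤ : Subgroup G).lowerCentralSeries (n + 1) with hN
    let π := QuotientGroup.mk' N
    have hπ : Function.Surjective π := QuotientGroup.mk'_surjective N
    have htop : (⊤ : Subgroup G).map π = ⊤ := map_top_of_surjective π hπ
    have hcomm : (commutator G).map π = commutator (G ⧸ N) := by
      rw [_root_.commutator_def, map_commutator, htop, _root_.commutator_def]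
    have hQ : (⊤ : Subgroup (G ⧸ N)).lowerCentralSeries (n + 1) = ⊥ := by
      rw [← htop, ← map_lowerCentralSeries, ← hN, Subgroup.map_eq_bot_iff, QuotientGroup.ker_mk']
    have hgen : closure {π r, π s} ⊔ commutator (G ⧸ N) = ⊤ := by
      rw [← hcomm, ← Set.image_pair, ← MonoidHom.map_closure, ← Subgroup.map_sup, h, htop]
    obtain ⟨u', v', huv⟩ := ih hQ hgen (hcomm ▸ mem_map_of_mem π hg)
    obtain ⟨u, rfl⟩ := hπ u'
    obtain ⟨v, rfl⟩ := hπ v'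
    have hz : (⁅r, u⁆ * ⁅s, v⁆)⁻¹ * g ∈ N := by
      rw [← QuotientGroup.ker_mk' N, MonoidHom.mem_ker]
      change π _ = 1
      rw [map_mul, map_inv, map_mul, map_commutatorElement, map_commutatorElement, huv,
        inv_mul_cancel]
    have hcen : N ≤ center G := by
      rw [← centralizer_univ, ← coe_top, ← commutator_eq_bot_iff_le_centralizer]
      exact hG
    obtain ⟨u₁, v₁, e, hu, hv⟩ := exists_commutator_mul_of_central
      ((⊤ : Subgroup G).lowerCentralSeries n) hcen h hz
    have split : ∀ t x y : G, ⁅t, y⁆ ∈ center G → ⁅t, x * y⁆ = ⁅t, x⁆ * ⁅t, y⁆ := by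
      intro t x y ht
      have h1 := mem_center_iff.mp ht x
      calc ⁅t, x * y⁆ = ⁅t, x⁆ * (x * ⁅t, y⁆ * x⁻¹) := by
            simp only [commutatorElement_def]; group
        _ = _ := by rw [h1]; group
    refine ⟨u * u₁, v * v₁, ?_⟩
    rw [split _ _ _ hu, split _ _ _ hv, ← mul_inv_cancel_left (⁅r, u⁆ * ⁅s, v⁆) g, e]
    have h1 := mem_center_iff.mp hu ⁅s, v⁆
    calc ⁅r, u⁆ * ⁅s, v⁆ * (⁅r, u₁⁆ * ⁅s, v₁⁆)
        = ⁅r, u⁆ * (⁅s, v⁆ * ⁅r, u₁⁆) * ⁅s, v₁⁆ := by group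
      _ = _ := by rw [h1]; group

open Subgroup commutatorElement in
/-- In a nilpotent group, `a` can be expressed through the values `b³a²` and `(ab)⁵a⁻²` of
Howie's relators, and one commutator
with each of these values. -/
lemma exists_eq_howie_relators_mul_commutators {G : Type*} [Group G] [Group.IsNilpotent G]
    (a b : G) :
    ∃ u v : G,
      a = (b ^ 3 * a ^ 2) ^ 5 * (((a * b) ^ 5 * (a ^ 2)⁻¹) ^ 3)⁻¹ *
        (⁅b ^ 3 * a ^ 2, u⁆ * ⁅(a * b) ^ 5 * (a ^ 2)⁻¹, v⁆) := by
  let H := closure {a, b}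
  let x : H := ⟨a, subset_closure (by simp)⟩
  let y : H := ⟨b, subset_closure (by simp)⟩
  have hxy : closure {x, y} = ⊤ := by
    rw [← map_subtype_inj, MonoidHom.map_closure, Set.image_pair, ← MonoidHom.range_eq_map,
      range_subtype]
    rfl
  set r := y ^ 3 * x ^ 2 with hr
  set s := (x * y) ^ 5 * (x ^ 2)⁻¹ with hs
  have hmem : ∀ {g k : H}, Abelianization.of g = Abelianization.of k →
      g⁻¹ * k ∈ commutator H := fun {g k} e => by
    rw [← Abelianization.ker_of, MonoidHom.mem_ker, map_mul, map_inv, e, inv_mul_cancel]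
  have hx : (r ^ 5 * (s ^ 3)⁻¹)⁻¹ * x ∈ commutator H := hmem <| by
    have : ∀ p q : Additive (Abelianization H),
        (5 : ℕ) • ((3 : ℕ) • q + (2 : ℕ) • p) +
          -((3 : ℕ) • ((5 : ℕ) • (p + q) + -((2 : ℕ) • p))) = p := fun p q => by abel
    simp only [hr, hs, map_mul, map_pow, map_inv]
    exact this (Additive.ofMul (Abelianization.of x)) (Additive.ofMul (Abelianization.of y))
  have hy : ((r ^ 3)⁻¹ * s ^ 2)⁻¹ * y ∈ commutator H := hmem <| by
    have : ∀ p q : Additive (Abelianization H),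
        -((3 : ℕ) • ((3 : ℕ) • q + (2 : ℕ) • p)) +
          (2 : ℕ) • ((5 : ℕ) • (p + q) + -((2 : ℕ) • p)) = q := fun p q => by abel
    simp only [hr, hs, map_mul, map_pow, map_inv]
    exact this (Additive.ofMul (Abelianization.of x)) (Additive.ofMul (Abelianization.of y))
  have hgen : closure {r, s} ⊔ commutator H = ⊤ := by
    have hle : closure {r, s} ≤ closure {r, s} ⊔ commutator H := le_sup_left
    have hr' : r ∈ closure {r, s} ⊔ commutator H := hle (subset_closure (by simp))
    have hs' : s ∈ closure {r, s} ⊔ commutator H := hle (subset_closure (by simp))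
    rw [eq_top_iff, ← hxy, closure_le]
    rintro g (rfl | rfl)
    · refine (Subgroup.mul_mem_cancel_left _ (inv_mem ?_)).mp (le_sup_right (a := closure {r, s}) hx)
      exact mul_mem (pow_mem hr' 5) (inv_mem (pow_mem hs' 3))
    · refine (Subgroup.mul_mem_cancel_left _ (inv_mem ?_)).mp (le_sup_right (a := closure {r, s}) hy)
      exact mul_mem (inv_mem (pow_mem hr' 3)) (pow_mem hs' 2)
  obtain ⟨n, hn⟩ := Subgroup.nilpotent_iff_lowerCentralSeries.mp
    (inferInstance : Group.IsNilpotent H)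
  have hn' : (⊤ : Subgroup H).lowerCentralSeries (n + 1) = ⊥ :=
    eq_bot_iff.mpr (hn ▸ Subgroup.lowerCentralSeries_antitone _ n.le_succ)
  obtain ⟨u, v, e⟩ := exists_commutator_mul_of_lowerCentralSeries_eq_bot n hn' hgen hx
  exact ⟨u, v, congrArg Subtype.val (inv_mul_eq_iff_eq_mul.mp e)⟩

namespace IsBiInvMetric

variable {G : Type*} [Group G] {d : G → G → ℝ}

lemma dist_self (hd : IsBiInvMetric d) (g : G) : d g g = 0 := (hd.1 g g).mpr rfl

lemma dist_mul_mul_le (hd : IsBiInvMetric d) (g h g' h' : G) :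
    d (g * h) (g' * h') ≤ d g g' + d h h' := by
  obtain ⟨-, -, triangle, left, right⟩ := hd
  have := triangle (g * h) (g' * h) (g' * h')
  rwa [left, right] at this

lemma dist_pow_pow_le (hd : IsBiInvMetric d) (g h : G) (n : ℕ) :
    d (g ^ n) (h ^ n) ≤ n * d g h := by
  induction n with
  | zero => simp [hd.dist_self]
  | succ n ih =>
    rw [pow_succ, pow_succ]
    push_cast
    linarith [hd.dist_mul_mul_le (g ^ n) g (h ^ n) h]

lemma dist_one_mul_le_s10 (hd : IsBiInvMetric d) (g h : G) : d 1 (g * h) ≤ d 1 g + d 1 h := by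
  simpa using hd.dist_mul_mul_le 1 1 g h

lemma dist_one_pow_le (hd : IsBiInvMetric d) (g : G) (n : ℕ) : d 1 (g ^ n) ≤ n * d 1 g := by
  simpa using hd.dist_pow_pow_le 1 g n

lemma dist_one_mul_inv (hd : IsBiInvMetric d) (g h : G) : d 1 (g * h⁻¹) = d h g := by
  simpa using (hd.2.2.2.2 h 1 (g * h⁻¹)).symm

lemma dist_one_inv_s10 (hd : IsBiInvMetric d) (g : G) : d 1 g⁻¹ = d 1 g := by
  simpa [hd.2.1 g 1] using hd.dist_one_mul_inv 1 g

open scoped commutatorElement in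
lemma dist_one_commutator_le (hd : IsBiInvMetric d) (g u : G) : d 1 ⁅g, u⁆ ≤ 2 * d 1 g := by
  have h1 := hd.dist_one_mul_le_s10 g (u * g⁻¹ * u⁻¹)
  have h2 : d 1 (u * g⁻¹ * u⁻¹) = d 1 g := by
    rw [hd.dist_one_mul_inv, ← hd.dist_one_inv_s10 g]
    simpa using hd.2.2.2.1 u 1 g⁻¹
  rw [commutatorElement_def, mul_assoc, mul_assoc, ← mul_assoc u]
  linarith

open scoped commutatorElement in
/-- In a nilpotent group, `a` is close to `1` if both of Howie's relators are. -/
lemma dist_one_le_of_howie_relators (hd : IsBiInvMetric d) [Group.IsNilpotent G] {a b : G}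
    {η : ℝ} (hr : d 1 (b ^ 3 * a ^ 2) ≤ η) (hs : d 1 ((a * b) ^ 5 * (a ^ 2)⁻¹) ≤ η) :
    d 1 a ≤ 12 * η := by
  obtain ⟨u, v, e⟩ := exists_eq_howie_relators_mul_commutators a b
  set r := b ^ 3 * a ^ 2
  set s := (a * b) ^ 5 * (a ^ 2)⁻¹
  have h1 := hd.dist_one_mul_le_s10 (r ^ 5 * (s ^ 3)⁻¹) (⁅r, u⁆ * ⁅s, v⁆)
  have h2 := hd.dist_one_mul_le_s10 (r ^ 5) (s ^ 3)⁻¹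
  have h3 := hd.dist_one_mul_le_s10 ⁅r, u⁆ ⁅s, v⁆
  have h4 := hd.dist_one_pow_le r 5
  have h5 := hd.dist_one_pow_le s 3
  have h6 := hd.dist_one_commutator_le r u
  have h7 := hd.dist_one_commutator_le s v
  rw [hd.dist_one_inv_s10] at h2
  rw [← e] at h1
  push_cast at h4 h5
  linarith

lemma dist_pow_map_pow_le {Γ : Type*} [Group Γ] (hd : IsBiInvMetric d) {φ : Γ → G}
    {S : Finset Γ} {ε : ℝ}
    (hφ : ∀ g h : Γ, g ∈ S → h ∈ S → g * h ∈ S → d (φ g * φ h) (φ (g * h)) < ε)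
    (g : Γ) (n : ℕ) (hS : ∀ i ≤ n, g ^ (i + 1) ∈ S) :
    d (φ g ^ (n + 1)) (φ (g ^ (n + 1))) ≤ n * ε := by
  induction n with
  | zero => simp [hd.dist_self]
  | succ n ih =>
    have h1 := ih fun i hi => hS i (hi.trans n.le_succ)
    have h2 := hφ (g ^ (n + 1)) g (hS n n.le_succ) (by simpa using hS 0 (Nat.zero_le _))
      (by simpa only [← pow_succ] using hS (n + 1) le_rfl)
    have h3 := hd.dist_mul_mul_le (φ g ^ (n + 1)) (φ g) (φ (g ^ (n + 1))) (φ g)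
    have h4 := hd.2.2.1 (φ g ^ (n + 1) * φ g) (φ (g ^ (n + 1)) * φ g) (φ (g ^ (n + 1) * g))
    rw [hd.dist_self] at h3
    rw [pow_succ, pow_succ g]
    push_cast
    linarith

end IsBiInvMetric

/-- In a Nil-approximated group, Howie's relations `y³x² = 1` and `(xy)⁵ = x²` force `x = 1`. -/
lemma IsNilApproximated.eq_one_of_howie_relations {Γ : Type*} [Group Γ]
    (hΓ : IsNilApproximated Γ) {x y : Γ} (h₁ : y ^ 3 * x ^ 2 = 1) (h₂ : (x * y) ^ 5 = x ^ 2) :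
    x = 1 := by
  classical
  obtain ⟨δ, -, hδ, happrox⟩ := hΓ
  by_contra hx
  have hpos := hδ x hx
  let S : Finset Γ := (Finset.range 6).image (x ^ ·) ∪ (Finset.range 6).image (y ^ ·) ∪
    (Finset.range 6).image ((x * y) ^ ·)
  have hxS : ∀ i < 6, x ^ i ∈ S := fun i hi => by
    simp only [S, Finset.mem_union, Finset.mem_image, Finset.mem_range]
    exact .inl (.inl ⟨i, hi, rfl⟩)
  have hyS : ∀ i < 6, y ^ i ∈ S := fun i hi => by
    simp only [S, Finset.mem_union, Finset.mem_image, Finset.mem_range]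
    exact .inl (.inr ⟨i, hi, rfl⟩)
  have hxyS : ∀ i < 6, (x * y) ^ i ∈ S := fun i hi => by
    simp only [S, Finset.mem_union, Finset.mem_image, Finset.mem_range]
    exact .inr ⟨i, hi, rfl⟩
  have hx₁ : x ∈ S := by simpa using hxS 1 (by norm_num)
  have hy₁ : y ∈ S := by simpa using hyS 1 (by norm_num)
  have hxy₁ : x * y ∈ S := by simpa using hxyS 1 (by norm_num)
  have h1S : (1 : Γ) ∈ S := by simpa using hxS 0 (by norm_num)
  obtain ⟨G, _, _, _, d, φ, hd, hφ, hlow⟩ := happrox S (δ x / 121) (by positivity)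
  set ε := δ x / 121 with hε
  set a := φ x
  set b := φ y
  have ha := hd.dist_pow_map_pow_le hφ x 1 fun i hi => hxS _ (by omega)
  have hb := hd.dist_pow_map_pow_le hφ y 2 fun i hi => hyS _ (by omega)
  have hab := hd.dist_pow_map_pow_le hφ (x * y) 4 fun i hi => hxyS _ (by omega)
  norm_num at ha hb hab
  have hone : d 1 (φ 1) ≤ ε := by
    have h := hφ 1 1 h1S h1S (by simpa using h1S)
    rw [mul_one, hd.2.1] at h
    have h' := hd.2.2.2.1 (φ 1) 1 (φ 1)
    rw [mul_one] at h'
    linarith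
  have hr : d 1 (b ^ 3 * a ^ 2) ≤ 10 * ε := by
    have e1 := hd.dist_mul_mul_le (b ^ 3) (a ^ 2) (φ (y ^ 3)) (φ (x ^ 2))
    have e2 := hφ (y ^ 3) (x ^ 2) (hyS 3 (by norm_num)) (hxS 2 (by norm_num)) (h₁ ▸ h1S)
    rw [h₁] at e2
    have e3 := hd.2.2.1 (b ^ 3 * a ^ 2) (φ (y ^ 3) * φ (x ^ 2)) (φ 1)
    have e4 := hd.2.2.1 1 (φ 1) (b ^ 3 * a ^ 2)
    rw [hd.2.1 (φ 1) (b ^ 3 * a ^ 2)] at e4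
    linarith
  have hs : d 1 ((a * b) ^ 5 * (a ^ 2)⁻¹) ≤ 10 * ε := by
    rw [hd.dist_one_mul_inv, hd.2.1]
    have e1 := hd.dist_pow_pow_le (a * b) (φ (x * y)) 5
    have e2 := hφ x y hx₁ hy₁ hxy₁
    have e3 := hd.2.2.1 ((a * b) ^ 5) (φ (x * y) ^ 5) (φ (x ^ 2))
    have e4 := hd.2.2.1 ((a * b) ^ 5) (φ (x ^ 2)) (a ^ 2)
    rw [hd.2.1 (φ (x ^ 2)) (a ^ 2)] at e4
    rw [h₂] at hab
    push_cast at e1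
    linarith
  have := hd.dist_one_le_of_howie_relators hr hs
  have := hlow x hx₁
  linarith

/-- Howie's group `⟨x, y | x⁻²y⁻³, x⁻²(xy)⁵⟩` is not Nil-approximated. -/
theorem howie_group_not_nil_approximated :
    ¬ IsNilApproximated (FreeGroup (Fin 2) ⧸ Subgroup.normalClosure
      ({FreeGroup.of 0 ^ (-2 : ℤ) * FreeGroup.of 1 ^ (-3 : ℤ),
        FreeGroup.of 0 ^ (-2 : ℤ) * (FreeGroup.of 0 * FreeGroup.of 1) ^ (5 : ℕ)} :
        Set (FreeGroup (Fin 2)))) := by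
  intro h
  set R : Set (FreeGroup (Fin 2)) := {FreeGroup.of 0 ^ (-2 : ℤ) * FreeGroup.of 1 ^ (-3 : ℤ),
    FreeGroup.of 0 ^ (-2 : ℤ) * (FreeGroup.of 0 * FreeGroup.of 1) ^ (5 : ℕ)} with hR
  have h₁ : FreeGroup.of 0 ^ (-2 : ℤ) * FreeGroup.of 1 ^ (-3 : ℤ) ∈ Subgroup.normalClosure R :=
    Subgroup.subset_normalClosure (by simp [hR])
  have h₂ : FreeGroup.of 0 ^ (-2 : ℤ) * (FreeGroup.of 0 * FreeGroup.of 1) ^ (5 : ℕ) ∈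
      Subgroup.normalClosure R := Subgroup.subset_normalClosure (by simp [hR])
  rw [← QuotientGroup.eq_one_iff] at h₁ h₂
  have hx := h.eq_one_of_howie_relations (x := QuotientGroup.mk (FreeGroup.of 0))
    (y := QuotientGroup.mk (FreeGroup.of 1))
    (by simpa [zpow_neg, ← mul_inv_rev, inv_eq_one] using h₁)
    (by simpa [zpow_neg] using (inv_mul_eq_one.mp (by simpa [zpow_neg] using h₂)).symm)
  -- `x ↦ (0 1)(2 3)`, `y ↦ (0 2 4)` extends to a homomorphism to the alternating group.
  let f : FreeGroup (Fin 2) →* Equiv.Perm (Fin 5) := FreeGroup.lift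
    ![Equiv.swap 0 1 * Equiv.swap 2 3, Equiv.swap 0 2 * Equiv.swap 2 4]
  have hf : Subgroup.normalClosure R ≤ f.ker := by
    refine Subgroup.normalClosure_le_normal ?_
    rintro g (rfl | rfl)
    · simp only [f, SetLike.mem_coe, MonoidHom.mem_ker, map_mul, map_pow, map_inv,
        FreeGroup.lift_apply_of, zpow_neg, zpow_ofNat]
      decide
    · simp only [f, SetLike.mem_coe, MonoidHom.mem_ker, map_mul, map_pow, map_inv,
        FreeGroup.lift_apply_of, zpow_neg, zpow_ofNat]
      set_option maxRecDepth 10000 in decide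
  have hf₀ := MonoidHom.mem_ker.mp (hf ((QuotientGroup.eq_one_iff _).mp hx))
  simp only [f, FreeGroup.lift_apply_of] at hf₀
  revert hf₀
  decide
end
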